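/- arXiv:1805.09530 — 6 statements merged into one kernel-verified Lean document; each statement's English description precedes it below -/
import Mathlib

section
/- Let θ be a stationary measure of the lifted chain L and let p be a solution of the master equation of L with p(t)(x) > 0 for all states x and all t > 0. Assume that for every t > 0: the relative entropy D(t) = Σ_x p(t)(x)·log(p(t)(x)/θ(x)) converges absolutely and is finite; D is differentiable at t with D'(t) = Σ_x (d/dt p(t)(x))·(log(p(t)(x)/θ(x)) + 1), this sum converging absolutely; and Σ_{(i,α)} Σ_{j≠i} p(t)(i,α)·q i j·|log((p(t)(i,α)·θ(j, α+v i j))/(θ(i,α)·p(t)(j, α+v i j)))| < ∞ (summands with q i j = 0 taken to be 0). Then D is monotonically non-increasing on (0,∞). -/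
open Filter

noncomputable section

/-- Right-hand side of the master equation of the lifted chain `L` at state `x`. -/
def mEqDeriv {S : Type} [Fintype S] [DecidableEq S] {n : ℕ}
    (q : S → S → ℝ) (v : S → S → (Fin n → ℤ))
    (f : S × (Fin n → ℤ) → ℝ) (x : S × (Fin n → ℤ)) : ℝ :=
  ∑ j ∈ Finset.univ.erase x.1,
    (f (j, x.2 + v x.1 j) * q j x.1 - f x * q x.1 j)

/-- `p` is a solution of the master equation of the lifted chain `L`. -/
def IsMasterSolution {S : Type} [Fintype S] [DecidableEq S] {n : ℕ}
    (q : S → S → ℝ) (v : S → S → (Fin n → ℤ))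
    (p : ℝ → S × (Fin n → ℤ) → ℝ) : Prop :=
  (∀ t : ℝ, 0 ≤ t → (∀ x, 0 ≤ p t x) ∧ (∑' x, p t x) = 1) ∧
  (∀ (x : S × (Fin n → ℤ)) (t : ℝ), 0 ≤ t →
    HasDerivWithinAt (fun s => p s x) (mEqDeriv q v (p t) x) (Set.Ici 0) t)

/-- Entropy production of a jump process. `e = (x, s)` is a directed edge leaving `x` with rate
`w e`, and the involution `σ` reverses edges, so that `(σ e).1` is the target of `e`. -/
theorem tsum_entropy_production_nonpos {X S : Type*} [Fintype S] (σ : X × S ≃ X × S)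
    (hσ : ∀ e, σ (σ e) = e) (w : X × S → ℝ) (hw : ∀ e, 0 ≤ w e) (C : ℝ) (hC : ∀ e, w e ≤ C)
    (θ p : X → ℝ) (hθ : ∀ x, 0 < θ x) (hp : ∀ x, 0 < p x) (hps : Summable p)
    (hstat : ∀ x, ∑ s, θ (σ (x, s)).1 * w (σ (x, s)) = ∑ s, θ x * w (x, s))
    (hent : Summable fun x => |p x * Real.log (p x / θ x)|)
    (hflux : Summable fun e : X × S =>
      p e.1 * w e * |Real.log (p e.1 / θ e.1) - Real.log (p (σ e).1 / θ (σ e).1)|) :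
    ∑' x, (∑ s, (p (σ (x, s)).1 * w (σ (x, s)) - p x * w (x, s))) *
      (Real.log (p x / θ x) + 1) ≤ 0 := by
  set g : X → ℝ := fun x => Real.log (p x / θ x) with hg
  have lift_summable : ∀ f : X → ℝ, (∀ x, 0 ≤ f x) → Summable f →
      Summable fun e : X × S => f e.1 * C := fun f hf hs => by
    have := hs.mul_of_nonneg (g := fun _ : S => (1 : ℝ)) Summable.of_finite hf
      (fun _ => zero_le_one)
    simpa using this.mul_right C
  have hA : Summable fun e : X × S => p e.1 * w e :=
    Summable.of_nonneg_of_le (fun e => mul_nonneg (hp _).le (hw e))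
      (fun e => mul_le_mul_of_nonneg_left (hC e) (hp _).le)
      (lift_summable p (fun x => (hp x).le) hps)
  have hB : Summable fun e : X × S => p e.1 * w e * g e.1 := by
    refine Summable.of_norm_bounded (lift_summable _ (fun x => abs_nonneg _) hent) fun e => ?_
    rw [show p e.1 * w e * g e.1 = p e.1 * g e.1 * w e by ring, norm_mul, Real.norm_eq_abs,
      Real.norm_of_nonneg (hw e)]
    exact mul_le_mul_of_nonneg_left (hC e) (abs_nonneg _)
  have hF : Summable fun e : X × S => p e.1 * w e * (g (σ e).1 - g e.1) := by
    refine Summable.of_norm_bounded hflux fun e => ?_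
    rw [norm_mul, Real.norm_of_nonneg (mul_nonneg (hp _).le (hw e)), Real.norm_eq_abs,
      abs_sub_comm]
  have hG : Summable fun e : X × S => p e.1 * w e * g (σ e).1 :=
    (hF.add hB).congr fun e => by ring
  have hGσ : Summable fun e : X × S => p (σ e).1 * w (σ e) * g e.1 :=
    ((σ.summable_iff).2 hG).congr fun e => by simp [hσ]
  have tsum_Gσ : ∑' e : X × S, p (σ e).1 * w (σ e) * g e.1 =
      ∑' e : X × S, p e.1 * w e * g (σ e).1 := by
    rw [← σ.tsum_eq]
    simp [hσ]
  have hAσ : Summable fun e : X × S => p (σ e).1 * w (σ e) := (σ.summable_iff).2 hA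
  have tsum_Aσ : ∑' e : X × S, p (σ e).1 * w (σ e) = ∑' e : X × S, p e.1 * w e :=
    σ.tsum_eq fun e : X × S => p e.1 * w e
  have hasSum_H : HasSum (fun e : X × S => (p (σ e).1 * w (σ e) - p e.1 * w e) * (g e.1 + 1))
      (∑' e : X × S, p e.1 * w e * (g (σ e).1 - g e.1)) := by
    have h := (hGσ.hasSum.sub hB.hasSum).add (hAσ.hasSum.sub hA.hasSum)
    rw [tsum_Gσ, tsum_Aσ, sub_self, add_zero, ← hG.tsum_sub hB] at h
    have integrand_eq : ∀ e : X × S, (p (σ e).1 * w (σ e) - p e.1 * w e) * (g e.1 + 1) =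
        p (σ e).1 * w (σ e) * g e.1 - p e.1 * w e * g e.1 +
          (p (σ e).1 * w (σ e) - p e.1 * w e) := fun e => by ring
    simp only [integrand_eq, mul_sub]
    exact h
  have fiber_sum : ∀ x, ∑ s, w (σ (x, s)) * p x * θ (σ (x, s)).1 / θ x =
      ∑ s, p x * w (x, s) := fun x => by
    have hx := (hθ x).ne'
    calc _ = p x / θ x * ∑ s, θ (σ (x, s)).1 * w (σ (x, s)) := by
          rw [Finset.mul_sum]; exact Finset.sum_congr rfl fun s _ => by ring
      _ = _ := by
          rw [hstat, Finset.mul_sum]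
          exact Finset.sum_congr rfl fun s _ => by field_simp
  have hKσ : Summable fun e : X × S => w (σ e) * p e.1 * θ (σ e).1 / θ e.1 := by
    rw [summable_prod_of_nonneg fun e =>
      div_nonneg (mul_nonneg (mul_nonneg (hw _) (hp _).le) (hθ _).le) (hθ _).le]
    refine ⟨fun _ => Summable.of_finite, ?_⟩
    simp only [tsum_fintype, fiber_sum]
    simpa only [tsum_fintype] using hA.prod
  have tsum_Kσ : ∑' e : X × S, w (σ e) * p e.1 * θ (σ e).1 / θ e.1 =
      ∑' e : X × S, p e.1 * w e := by
    rw [hKσ.tsum_prod, hA.tsum_prod]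
    simp only [tsum_fintype, fiber_sum]
  have hK : Summable fun e : X × S => w e * p (σ e).1 * θ e.1 / θ (σ e).1 :=
    ((σ.summable_iff).2 hKσ).congr fun e => by simp [hσ]
  have tsum_K : ∑' e : X × S, w e * p (σ e).1 * θ e.1 / θ (σ e).1 =
      ∑' e : X × S, p e.1 * w e := by
    rw [← tsum_Kσ, ← σ.tsum_eq]
    simp [hσ]
  have pointwise_le : ∀ e : X × S, p e.1 * w e * (g (σ e).1 - g e.1) ≤
      w e * p (σ e).1 * θ e.1 / θ (σ e).1 - p e.1 * w e := fun e => by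
    have h1 := hp e.1
    have h2 := hp (σ e).1
    have h3 := hθ e.1
    have h4 := hθ (σ e).1
    have hlog : g (σ e).1 - g e.1 ≤ p (σ e).1 / θ (σ e).1 / (p e.1 / θ e.1) - 1 := by
      rw [hg]
      simp only
      rw [← Real.log_div (div_pos h2 h4).ne' (div_pos h1 h3).ne']
      exact Real.log_le_sub_one_of_pos (div_pos (div_pos h2 h4) (div_pos h1 h3))
    refine (mul_le_mul_of_nonneg_left hlog (mul_nonneg h1.le (hw e))).trans_eq ?_
    field_simp
  calc _ = ∑' e : X × S, (p (σ e).1 * w (σ e) - p e.1 * w e) * (g e.1 + 1) := by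
        rw [hasSum_H.summable.tsum_prod]
        simp only [tsum_fintype, Finset.sum_mul, hg]
    _ = ∑' e : X × S, p e.1 * w e * (g (σ e).1 - g e.1) := hasSum_H.tsum_eq
    _ ≤ ∑' e : X × S, (w e * p (σ e).1 * θ e.1 / θ (σ e).1 - p e.1 * w e) :=
        hF.tsum_le_tsum pointwise_le (hK.sub hA)
    _ = 0 := by rw [hK.tsum_sub hA, tsum_K, sub_self]

/-- Reversal of the directed edges of the lifted chain, an edge from `(i, α)` to
`(j, α + v i j)` being recorded as `((i, α), j)`. -/
def edgeReversal {S : Type} {n : ℕ} (v : S → S → (Fin n → ℤ)) (hv : ∀ i j, v j i = -(v i j)) :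
    (S × (Fin n → ℤ)) × S ≃ (S × (Fin n → ℤ)) × S :=
  Function.Involutive.toPerm (fun e => ((e.2, e.1.2 + v e.1.1 e.2), e.1.1))
    fun e => by simp [hv e.1.1 e.2]

theorem edgeReversal_apply {S : Type} {n : ℕ} (v : S → S → (Fin n → ℤ))
    (hv : ∀ i j, v j i = -(v i j)) (e : (S × (Fin n → ℤ)) × S) :
    edgeReversal v hv e = ((e.2, e.1.2 + v e.1.1 e.2), e.1.1) :=
  rfl

theorem stmt_0 {S : Type} [Fintype S] [DecidableEq S] (hS : 2 ≤ Fintype.card S) {n : ℕ}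
    (q : S → S → ℝ)
    (hq_nonneg : ∀ i j : S, i ≠ j → 0 ≤ q i j)
    (hq_sym : ∀ i j : S, i ≠ j → (0 < q i j ↔ 0 < q j i))
    (hq_conn : ∀ i j : S, Relation.ReflTransGen (fun a b => a ≠ b ∧ 0 < q a b) i j)
    (v : S → S → (Fin n → ℤ)) (hv : ∀ i j, v j i = -(v i j))
    (θ : S × (Fin n → ℤ) → ℝ) (hθpos : ∀ x, 0 < θ x)
    (hθstat : ∀ (i : S) (α : Fin n → ℤ),
      ∑ j ∈ Finset.univ.erase i, (θ (j, α + v i j) * q j i - θ (i, α) * q i j) = 0)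
    (p : ℝ → S × (Fin n → ℤ) → ℝ)
    (hp : IsMasterSolution q v p)
    (hppos : ∀ t : ℝ, 0 < t → ∀ x, 0 < p t x)
    -- (a) the relative entropy converges absolutely (hence is finite):
    (hDabs : ∀ t : ℝ, 0 < t →
      Summable (fun x : S × (Fin n → ℤ) => |p t x * Real.log (p t x / θ x)|))
    -- (b) D is differentiable with the stated derivative, converging absolutely:
    (hD'abs : ∀ t : ℝ, 0 < t →
      Summable (fun x : S × (Fin n → ℤ) =>
        |mEqDeriv q v (p t) x * (Real.log (p t x / θ x) + 1)|))
    (hD' : ∀ t : ℝ, 0 < t →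
      HasDerivAt (fun s : ℝ => ∑' x : S × (Fin n → ℤ), p s x * Real.log (p s x / θ x))
        (∑' x : S × (Fin n → ℤ),
          mEqDeriv q v (p t) x * (Real.log (p t x / θ x) + 1)) t)
    -- (c) the flux-entropy sum converges absolutely:
    (hflux : ∀ t : ℝ, 0 < t →
      Summable (fun x : S × (Fin n → ℤ) =>
        ∑ j ∈ Finset.univ.erase x.1,
          p t x * q x.1 j *
            |Real.log ((p t x * θ (j, x.2 + v x.1 j)) / (θ x * p t (j, x.2 + v x.1 j)))|)) :
    -- D is monotonically non-increasing on (0, ∞):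
    ∀ s t : ℝ, 0 < s → s ≤ t →
      (∑' x : S × (Fin n → ℤ), p t x * Real.log (p t x / θ x)) ≤
        ∑' x : S × (Fin n → ℤ), p s x * Real.log (p s x / θ x) := by
  classical
  have hderiv_nonpos : ∀ t : ℝ, 0 < t → ∑' x : S × (Fin n → ℤ),
      mEqDeriv q v (p t) x * (Real.log (p t x / θ x) + 1) ≤ 0 := fun t ht => by
    set w : (S × (Fin n → ℤ)) × S → ℝ := fun e => if e.2 = e.1.1 then 0 else q e.1.1 e.2 with hw
    have sum_erase : ∀ (i : S) (f : S → ℝ), (f i = 0) →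
        ∑ j ∈ Finset.univ.erase i, f j = ∑ j, f j := fun i f hf => Finset.sum_erase _ hf
    have edge_sum : ∀ (f : S × (Fin n → ℤ) → ℝ) (x : S × (Fin n → ℤ)), mEqDeriv q v f x =
        ∑ s, (f (edgeReversal v hv (x, s)).1 * w (edgeReversal v hv (x, s)) - f x * w (x, s)) :=
      fun f x => by
        rw [← sum_erase x.1 _ (by simp [hw, edgeReversal_apply])]
        refine Finset.sum_congr rfl fun j hj => ?_
        have hj' := Finset.ne_of_mem_erase hj
        simp [hw, edgeReversal_apply, hj', hj'.symm]
    obtain ⟨C, hC⟩ := Finite.exists_le fun ij : S × S => |q ij.1 ij.2|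
    have hw_nonneg : ∀ e, 0 ≤ w e := fun e => by
      simp only [hw]
      split_ifs with h
      · exact le_rfl
      · exact hq_nonneg _ _ (Ne.symm h)
    simp only [edge_sum]
    refine tsum_entropy_production_nonpos (edgeReversal v hv)
      (Function.Involutive.toPerm_involutive _) w hw_nonneg C ?_ θ (p t) hθpos (hppos t ht) ?_ ?_
      (hDabs t ht) ?_
    · intro e
      simp only [hw]
      split_ifs with h
      · exact (abs_nonneg _).trans (hC (e.1.1, e.2))
      · exact (le_abs_self _).trans (hC (e.1.1, e.2))
    · by_contra h
      simpa [tsum_eq_zero_of_not_summable h] using (hp.1 t ht.le).2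
    · intro x
      rw [← sub_eq_zero, ← Finset.sum_sub_distrib, ← edge_sum]
      exact hθstat x.1 x.2
    · rw [summable_prod_of_nonneg fun e =>
        mul_nonneg (mul_nonneg (hppos t ht _).le (hw_nonneg e)) (abs_nonneg _)]
      refine ⟨fun _ => Summable.of_finite, (hflux t ht).congr fun x => ?_⟩
      rw [tsum_fintype, ← sum_erase x.1 _ (by simp [hw])]
      refine Finset.sum_congr rfl fun j hj => ?_
      have hx := hppos t ht x
      have hy := hppos t ht (j, x.2 + v x.1 j)
      have hθx := hθpos x
      have hθy := hθpos (j, x.2 + v x.1 j)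
      have hlog : Real.log (p t x * θ (j, x.2 + v x.1 j) / (θ x * p t (j, x.2 + v x.1 j))) =
          Real.log (p t x / θ x) -
            Real.log (p t (j, x.2 + v x.1 j) / θ (j, x.2 + v x.1 j)) := by
        rw [← Real.log_div (div_pos hx hθx).ne' (div_pos hy hθy).ne', div_div_div_eq]
      simp [hw, edgeReversal_apply, Finset.ne_of_mem_erase hj, hlog]
  intro s t hs hst
  refine antitoneOn_of_deriv_nonpos (convex_Ioi (0 : ℝ))
    (fun r hr => (hD' r hr).continuousAt.continuousWithinAt) ?_ ?_ hs (hs.trans_le hst) hst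
  · rw [interior_Ioi]
    exact fun r hr => (hD' r hr).differentiableAt.differentiableWithinAt
  · rw [interior_Ioi]
    intro r hr
    rw [(hD' r hr).deriv]
    exact hderiv_nonpos r hr

end
end

section
/- Let θ be a stationary measure of the lifted chain L and let p be a probability distribution on S × ℤ^n. Assume Σ_{(i,α)} Σ_{j ≠ i} p(i,α)·q i j·|log((θ(i,α)·q i j)/(θ(j, α + v i j)·q j i))| < ∞ (summands with q i j = 0 taken to be 0). Then the housekeeping heat Q_hk^θ = (1/2)·Σ_{(i,α)} Σ_{j ≠ i} (p(i,α)·q i j − p(j, α + v i j)·q j i)·log((θ(i,α)·q i j)/(θ(j, α + v i j)·q j i)) is nonnegative. -/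
open Filter

noncomputable section

/-- If `e` is an involution and `g` is summable, symmetrising `g` along `e` doubles the sum. -/
lemma tsum_sum_add_involutive {X S : Type*} [Fintype S] (e : X × S → X × S)
    (he : Function.Involutive e) (g : X × S → ℝ) (hg : Summable g) :
    ∑' x, ∑ j, (g (x, j) + g (e (x, j))) = 2 * ∑' x, ∑ j, g (x, j) := by
  have hge : Summable fun z => g (e z) := (he.toPerm.summable_iff (f := g)).2 hg
  have hsum : ∀ h : X × S → ℝ, Summable h → ∑' x, ∑ j, h (x, j) = ∑' z, h z := by
    intro h hh
    rw [hh.tsum_prod]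
    simp only [tsum_fintype]
  rw [hsum (fun z => g z + g (e z)) (hg.add hge), hsum g hg, hg.tsum_add hge,
    show ∑' z, g (e z) = ∑' z, g z from he.toPerm.tsum_eq g, two_mul]

/-- A function on a product with a finite type is summable once the finite sums of its absolute
values are. -/
lemma summable_prod_of_summable_sum_abs {X S : Type*} [Fintype S] (g : X × S → ℝ)
    (hg : Summable fun x => ∑ j, |g (x, j)|) : Summable g := by
  refine Summable.of_abs ((summable_prod_of_nonneg fun z => abs_nonneg (g z)).2 ⟨?_, ?_⟩)
  · exact fun x => Summable.of_finite
  · simpa only [tsum_fintype] using hg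

/-- The elementary bound `1 - 1 / r ≤ log r` at `r = (t * a) / (u * b)`, multiplied by `t * a`. -/
lemma mul_sub_mul_le_mul_log {t a u b : ℝ} (ht : 0 < t) (hu : 0 < u) (ha : 0 ≤ a)
    (hb : 0 ≤ b) (hab : 0 < a ↔ 0 < b) :
    t * a - u * b ≤ t * (a * Real.log ((t * a) / (u * b))) := by
  rcases ha.eq_or_lt with rfl | ha
  · have : b = 0 := le_antisymm (not_lt.1 fun h => lt_irrefl _ (hab.2 h)) hb
    simp [this]
  · have hb := hab.1 ha
    have h := Real.one_sub_inv_le_log_of_pos (x := (t * a) / (u * b)) (by positivity)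
    have h2 := mul_le_mul_of_nonneg_left h (mul_pos ht ha).le
    calc t * a - u * b = t * a * (1 - ((t * a) / (u * b))⁻¹) := by field_simp
      _ ≤ _ := by linarith

theorem stmt_2 {S : Type} [Fintype S] [DecidableEq S] (hS : 2 ≤ Fintype.card S) {n : ℕ}
    (q : S → S → ℝ)
    (hq_nonneg : ∀ i j : S, i ≠ j → 0 ≤ q i j)
    (hq_sym : ∀ i j : S, i ≠ j → (0 < q i j ↔ 0 < q j i))
    (hq_conn : ∀ i j : S, Relation.ReflTransGen (fun a b => a ≠ b ∧ 0 < q a b) i j)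
    (v : S → S → (Fin n → ℤ)) (hv : ∀ i j, v j i = -(v i j))
    -- θ is a stationary measure of L:
    (θ : S × (Fin n → ℤ) → ℝ) (hθpos : ∀ x, 0 < θ x)
    (hθstat : ∀ (i : S) (α : Fin n → ℤ),
      ∑ j ∈ Finset.univ.erase i, (θ (j, α + v i j) * q j i - θ (i, α) * q i j) = 0)
    -- p is a probability distribution on S × ℤ^n:
    (p : S × (Fin n → ℤ) → ℝ) (hp0 : ∀ x, 0 ≤ p x) (hp1 : (∑' x, p x) = 1)
    -- absolute convergence assumption (summands with q i j = 0 vanish):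
    (habs : Summable (fun x : S × (Fin n → ℤ) =>
      ∑ j ∈ Finset.univ.erase x.1,
        p x * q x.1 j *
          |Real.log ((θ x * q x.1 j) / (θ (j, x.2 + v x.1 j) * q j x.1))|)) :
    -- the housekeeping heat is nonnegative:
    0 ≤ (1 / 2) * ∑' x : S × (Fin n → ℤ),
          ∑ j ∈ Finset.univ.erase x.1,
            (p x * q x.1 j - p (j, x.2 + v x.1 j) * q j x.1) *
              Real.log ((θ x * q x.1 j) / (θ (j, x.2 + v x.1 j) * q j x.1)) := by
  have hv0 : ∀ i, v i i = 0 := fun i => self_eq_neg.1 (hv i i)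
  let e : (S × (Fin n → ℤ)) × S → (S × (Fin n → ℤ)) × S :=
    fun z => ((z.2, z.1.2 + v z.1.1 z.2), z.1.1)
  have he : Function.Involutive e := by
    rintro ⟨⟨i, α⟩, j⟩
    simp [e, hv i j]
  let F : (S × (Fin n → ℤ)) × S → ℝ := fun z =>
    Real.log ((θ z.1 * q z.1.1 z.2) / (θ (e z).1 * q z.2 z.1.1))
  let g : (S × (Fin n → ℤ)) × S → ℝ := fun z => p z.1 * q z.1.1 z.2 * F z
  have hF0 : ∀ x : S × (Fin n → ℤ), F (x, x.1) = 0 := by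
    rintro ⟨i, α⟩
    simp only [F, e, hv0, add_zero]
    rcases eq_or_ne (θ (i, α) * q i i) 0 with h | h
    · simp [h]
    · simp [div_self h]
  have hFe : ∀ z, F (e z) = -F z := by
    intro z
    have hz : F (e z) =
        Real.log ((θ (e z).1 * q z.2 z.1.1) / (θ (e (e z)).1 * q z.1.1 z.2)) := rfl
    rw [hz, he z, ← Real.log_inv, inv_div]
  have herase : ∀ (x : S × (Fin n → ℤ)) (f : S → ℝ), f x.1 = 0 →
      ∑ j ∈ Finset.univ.erase x.1, f j = ∑ j, f j :=
    fun x f hf => Finset.sum_erase _ hf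
  have hg : Summable g := by
    refine summable_prod_of_summable_sum_abs g (habs.congr fun x => ?_)
    rw [← herase x _ (by simp [g, hF0])]
    refine Finset.sum_congr rfl fun j hj => ?_
    rw [abs_mul, abs_of_nonneg
      (mul_nonneg (hp0 x) (hq_nonneg _ _ (Finset.ne_of_mem_erase hj).symm))]
  have hheat : ∀ x : S × (Fin n → ℤ), ∑ j ∈ Finset.univ.erase x.1,
      (p x * q x.1 j - p (j, x.2 + v x.1 j) * q j x.1) *
        Real.log ((θ x * q x.1 j) / (θ (j, x.2 + v x.1 j) * q j x.1)) =
      ∑ j, (g (x, j) + g (e (x, j))) := by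
    intro x
    rw [← herase x _ (by simp [g, hF0, hFe])]
    refine Finset.sum_congr rfl fun j _ => ?_
    simp only [g, hFe]
    simp only [F, e]
    ring
  simp only [hheat]
  rw [tsum_sum_add_involutive e he g hg]
  have hpos : 0 ≤ ∑' x, ∑ j, g (x, j) := by
    refine tsum_nonneg ?_
    rintro ⟨i, α⟩
    rw [← herase (i, α) _ (by simp [g, hF0])]
    have hstat : 0 ≤ θ (i, α) * ∑ j ∈ Finset.univ.erase i, q i j * F ((i, α), j) := by
      rw [Finset.mul_sum]
      calc (0 : ℝ) = ∑ j ∈ Finset.univ.erase i,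
            (θ (i, α) * q i j - θ (j, α + v i j) * q j i) := by
            rw [← neg_zero, ← hθstat i α, ← Finset.sum_neg_distrib]
            simp only [neg_sub]
        _ ≤ _ := Finset.sum_le_sum fun j hj => by
            have hij := (Finset.ne_of_mem_erase hj).symm
            exact mul_sub_mul_le_mul_log (hθpos _) (hθpos _) (hq_nonneg i j hij)
              (hq_nonneg j i hij.symm) (hq_sym i j hij)
    have h := mul_nonneg (hp0 (i, α)) (nonneg_of_mul_nonneg_right hstat (hθpos _))
    simpa only [g, Finset.mul_sum, mul_assoc] using h
  linarith

end
end

section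
/- Let (p^x) be a transition family for the lifted chain L, let r be a probability distribution on S × ℤ^n with finite entropy H[r] < ∞, and let p(t) = Σ_x r(x)·p^x(t). Assume: (i) for every t ≥ 0 the free energy F^π(t) is finite and the instantaneous entropy production rate e_p(t) is finite and locally integrable; (ii) the free-energy balance identity F^π(T) − F^π(0) + ∫₀^T e_p(t) dt = F̄(T) − F̄(0) + ∫₀^T ē_p(t) dt holds for all T > 0; (iii) the folded distribution p̄(t) converges pointwise to π̄ as t → ∞. Then e_p(t) converges to ē_p in Cesàro's sense: lim_{T→∞} (1/T)·∫₀^T e_p(t) dt = ē_p. -/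
open Filter MeasureTheory

noncomputable section

/-- A transition family for the lifted chain `L`: solutions started from point
masses satisfying the Chapman–Kolmogorov property. -/
def IsTransitionFamily {S : Type} [Fintype S] [DecidableEq S] {n : ℕ}
    (q : S → S → ℝ) (v : S → S → (Fin n → ℤ))
    (P : S × (Fin n → ℤ) → ℝ → S × (Fin n → ℤ) → ℝ) : Prop :=
  (∀ x, IsMasterSolution q v (P x)) ∧
  (∀ x, P x 0 x = 1 ∧ ∀ y, y ≠ x → P x 0 y = 0) ∧
  (∀ x z : S × (Fin n → ℤ), ∀ s t : ℝ, 0 ≤ s → 0 ≤ t →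
    P x (s + t) z = ∑' y, P x s y * P y t z)

/-- Instantaneous entropy production rate of the lifted chain at a distribution `f`. -/
def epL {S : Type} [Fintype S] [DecidableEq S] {n : ℕ}
    (q : S → S → ℝ) (v : S → S → (Fin n → ℤ)) (f : S × (Fin n → ℤ) → ℝ) : ℝ :=
  (1 / 2) * ∑' x : S × (Fin n → ℤ),
    ∑ j ∈ Finset.univ.erase x.1,
      (f x * q x.1 j - f (j, x.2 + v x.1 j) * q j x.1) *
        Real.log ((f x * q x.1 j) / (f (j, x.2 + v x.1 j) * q j x.1))

/-- Entropy production rate of the folded (finite) chain at a distribution `g`. -/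
def epBar {S : Type} [Fintype S] [DecidableEq S] (q : S → S → ℝ) (g : S → ℝ) : ℝ :=
  (1 / 2) * ∑ i : S, ∑ j ∈ Finset.univ.erase i,
    (g i * q i j - g j * q j i) * Real.log ((g i * q i j) / (g j * q j i))

/-- Free energy of `f` on the lifted chain w.r.t. the periodic measure `π(i,α) = π̄ i`. -/
def freeEnergyL {S : Type} [Fintype S] [DecidableEq S] {n : ℕ}
    (πb : S → ℝ) (f : S × (Fin n → ℤ) → ℝ) : ℝ :=
  ∑' x : S × (Fin n → ℤ), f x * Real.log (f x / πb x.1)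

/-- Free energy of the folded distribution `g` w.r.t. `π̄`. -/
def freeEnergyBar {S : Type} [Fintype S] (πb : S → ℝ) (g : S → ℝ) : ℝ :=
  ∑ i : S, g i * Real.log (g i / πb i)

/-- The folded distribution on `S` of a distribution on `S × ℤ^n`. -/
def foldD {S : Type} {n : ℕ} (f : S × (Fin n → ℤ) → ℝ) (i : S) : ℝ :=
  ∑' α : Fin n → ℤ, f (i, α)

/-- The solution started from initial distribution `r`, via the transition family `P`. -/
def mixSol {S : Type} {n : ℕ}
    (P : S × (Fin n → ℤ) → ℝ → S × (Fin n → ℤ) → ℝ)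
    (r : S × (Fin n → ℤ) → ℝ) (t : ℝ) (z : S × (Fin n → ℤ)) : ℝ :=
  ∑' x, r x * P x t z

/-- Mixtures `∑ₓ r x * k x y` of kernels of constant mass. -/
lemma hasSum_mixture {α β : Type*} {r : α → ℝ} {k : α → β → ℝ} {R m : ℝ}
    (hr0 : ∀ x, 0 ≤ r x) (hr : HasSum r R) (hk0 : ∀ x y, 0 ≤ k x y)
    (hk : ∀ x, HasSum (k x) m) :
    (∀ y, Summable fun x => r x * k x y) ∧
      HasSum (fun y => ∑' x, r x * k x y) (R * m) := by
  have hs : Summable (Function.uncurry fun x y => r x * k x y) := by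
    refine (summable_prod_of_nonneg fun z => mul_nonneg (hr0 _) (hk0 _ _)).2 ⟨fun x => ?_, ?_⟩
    · exact (hk x).summable.mul_left (r x)
    · have : (fun x => ∑' y, r x * k x y)
          = fun x => r x * m := by
        funext x
        exact ((hk x).mul_left (r x)).tsum_eq
      exact this ▸ (hr.mul_right m).summable
  have hs' := hs.prod_symm
  refine ⟨fun y => hs'.prod_factor y, ?_⟩
  have h1 : ∑' y, ∑' x, r x * k x y = R * m := by
    rw [hs.tsum_comm, ← (hr.mul_right m).tsum_eq]
    exact tsum_congr fun x => ((hk x).mul_left (r x)).tsum_eq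
  rw [← h1]
  exact hs'.prod.hasSum

/-- The orientation-reversing involution on oriented edges of the lifted graph. -/
def edgeFlip {S : Type} {n : ℕ} (v : S → S → (Fin n → ℤ)) (hv : ∀ i j, v j i = -(v i j)) :
    ((S × (Fin n → ℤ)) × S) ≃ ((S × (Fin n → ℤ)) × S) where
  toFun e := ((e.2, e.1.2 + v e.1.1 e.2), e.1.1)
  invFun e := ((e.2, e.1.2 + v e.1.1 e.2), e.1.1)
  left_inv e := by
    ext <;> simp [hv e.1.1 e.2]
  right_inv e := by
    ext <;> simp [hv e.1.1 e.2]

/-- Total jump rate, an upper bound for every exit rate. -/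
def totalRate {S : Type} [Fintype S] (q : S → S → ℝ) : ℝ := ∑ i, ∑ j, |q i j|

lemma totalRate_nonneg {S : Type} [Fintype S] (q : S → S → ℝ) : 0 ≤ totalRate q :=
  Finset.sum_nonneg fun _ _ => Finset.sum_nonneg fun _ _ => abs_nonneg _

lemma sum_rate_le_totalRate {S : Type} [Fintype S] (q : S → S → ℝ) (i : S) :
    ∑ j, |q i j| ≤ totalRate q :=
  Finset.single_le_sum (f := fun i => ∑ j, |q i j|)
    (fun _ _ => Finset.sum_nonneg fun _ _ => abs_nonneg _) (Finset.mem_univ i)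

lemma rate_le_totalRate {S : Type} [Fintype S] (q : S → S → ℝ) (i j : S) :
    |q i j| ≤ totalRate q :=
  (Finset.single_le_sum (f := fun j => |q i j|) (fun _ _ => abs_nonneg _)
    (Finset.mem_univ j)).trans (sum_rate_le_totalRate q i)

/-- Duality: the master equation moves the mean of a test function whose increments along
edges are at least `-K` by at least `-K` times a constant multiple of the total rate. -/
lemma neg_le_sum_mul_mEqDeriv {S : Type} [Fintype S] [DecidableEq S] {n : ℕ}
    {q : S → S → ℝ} (hq : ∀ i j : S, i ≠ j → 0 ≤ q i j)
    {v : S → S → (Fin n → ℤ)} (hv : ∀ i j, v j i = -(v i j))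
    {p : S × (Fin n → ℤ) → ℝ} (hp0 : ∀ x, 0 ≤ p x) (hp : HasSum p 1)
    {g : S × (Fin n → ℤ) → ℝ} {F : Finset (S × (Fin n → ℤ))}
    (hgF : ∀ y, y ∉ F → g y = 0) {K : ℝ} (hK : 0 ≤ K)
    (hg : ∀ i j α, -K ≤ g (j, α + v i j) - g (i, α)) :
    -(K * (totalRate q * Fintype.card S)) ≤ ∑ y ∈ F, g y * mEqDeriv q v p y := by
  set a : (S × (Fin n → ℤ)) × S → ℝ :=
    fun e => if e.2 = e.1.1 then 0 else p e.1 * q e.1.1 e.2 with ha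
  have ha0 : ∀ e, 0 ≤ a e := fun e => by
    simp only [ha]
    split_ifs with h
    · exact le_rfl
    · exact mul_nonneg (hp0 _) (hq _ _ (Ne.symm h))
  have hb : HasSum (fun e : (S × (Fin n → ℤ)) × S => p e.1 * totalRate q)
      (totalRate q * Fintype.card S) := by
    have h0 : ∀ x, HasSum (fun _ : S => p x * totalRate q)
        (p x * totalRate q * Fintype.card S) := fun x => by
      have := hasSum_fintype (fun _ : S => p x * totalRate q)
      simpa [mul_comm, mul_left_comm] using this
    have hs : Summable (fun e : (S × (Fin n → ℤ)) × S => p e.1 * totalRate q) := by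
      refine (summable_prod_of_nonneg fun e => mul_nonneg (hp0 _) (totalRate_nonneg q)).2
        ⟨fun x => (h0 x).summable, ?_⟩
      simp only [fun x => (h0 x).tsum_eq]
      exact (hp.summable.mul_right _).mul_right _
    have h1 := (hs.hasSum.prod_fiberwise h0).unique ((hp.mul_right _).mul_right _)
    rw [one_mul] at h1
    exact h1 ▸ hs.hasSum
  have hab : ∀ e, a e ≤ p e.1 * totalRate q := fun e => by
    simp only [ha]
    split_ifs with h
    · exact mul_nonneg (hp0 _) (totalRate_nonneg q)
    · exact mul_le_mul_of_nonneg_left ((le_abs_self _).trans (rate_le_totalRate q _ _)) (hp0 _)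
  have hasum : Summable a := .of_nonneg_of_le ha0 hab hb.summable
  obtain ⟨B, hB⟩ : ∃ B, ∀ y, |g y| ≤ B := by
    refine ⟨∑ y ∈ F, |g y|, fun y => ?_⟩
    by_cases hy : y ∈ F
    · exact Finset.single_le_sum (f := fun y => |g y|) (fun _ _ => abs_nonneg _) hy
    · rw [hgF y hy, abs_zero]
      exact Finset.sum_nonneg fun _ _ => abs_nonneg _
  have hmul : ∀ (h : (S × (Fin n → ℤ)) × S → ℝ) (b : (S × (Fin n → ℤ)) × S → ℝ),
      (∀ e, |h e| ≤ B) → (∀ e, 0 ≤ b e) → Summable b → Summable fun e => h e * b e := by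
    intro h b hh hb0 hbs
    refine .of_norm_bounded (hbs.mul_left B) fun e => ?_
    rw [norm_mul, Real.norm_eq_abs, Real.norm_eq_abs, abs_of_nonneg (hb0 e)]
    exact mul_le_mul_of_nonneg_right (hh e) (hb0 e)
  set φ := edgeFlip v hv with hφ
  have hφφ : ∀ e, φ (φ e) = e := fun e => φ.left_inv e
  have hs1 : Summable fun e => g e.1 * a (φ e) :=
    hmul (fun e => g e.1) (fun e => a (φ e)) (fun e => hB _) (fun e => ha0 _)
      (φ.summable_iff.2 hasum)
  have hs2 : Summable fun e => g e.1 * a e := hmul (fun e => g e.1) a (fun e => hB _) ha0 hasum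
  have hs3 : Summable fun e => g (φ e).1 * a e :=
    hmul (fun e => g (φ e).1) a (fun e => hB _) ha0 hasum
  have key : ∑ y ∈ F, g y * mEqDeriv q v p y = ∑' e, (g (φ e).1 - g e.1) * a e := by
    have e1 : ∑' e, (g (φ e).1 - g e.1) * a e
        = ∑' e, (g e.1 * a (φ e) - g e.1 * a e) := by
      simp only [sub_mul]
      rw [hs3.tsum_sub hs2, hs1.tsum_sub hs2, ← φ.tsum_eq (fun e => g (φ e).1 * a e)]
      simp only [hφφ]
    rw [e1, (hs1.sub hs2).tsum_prod, ← tsum_eq_sum (s := F) (L := .unconditional _)]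
    · refine tsum_congr fun y => ?_
      rw [tsum_fintype, mEqDeriv, Finset.mul_sum,
        ← Finset.sum_subset (Finset.subset_univ (Finset.univ.erase y.1))]
      · refine Finset.sum_congr rfl fun j hj => ?_
        have hj' : j ≠ y.1 := Finset.ne_of_mem_erase hj
        simp [ha, hφ, edgeFlip, hj', hj'.symm, mul_sub]
      · intro j _ hj
        have hj' : j = y.1 := by simpa using hj
        simp [ha, hφ, edgeFlip, hj']
    · intro y hy
      rw [hgF y hy, zero_mul]
  rw [key]
  have hs4 : Summable fun e => (g (φ e).1 - g e.1) * a e := by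
    simpa only [sub_mul] using hs3.sub hs2
  calc -(K * (totalRate q * Fintype.card S))
      = -(K * ∑' e : (S × (Fin n → ℤ)) × S, p e.1 * totalRate q) := by rw [hb.tsum_eq]
    _ ≤ -(K * ∑' e, a e) :=
      neg_le_neg (mul_le_mul_of_nonneg_left (hasum.tsum_le_tsum hab hb.summable) hK)
    _ = ∑' e, (-K) * a e := by rw [tsum_mul_left, neg_mul]
    _ ≤ ∑' e, (g (φ e).1 - g e.1) * a e :=
      (hasum.mul_left _).tsum_le_tsum
        (fun e => mul_le_mul_of_nonneg_right (hg e.1.1 e.2 e.1.2) (ha0 e)) hs4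

lemma hasSum_one_of_tsum_eq_one {α : Type*} {f : α → ℝ} (h : ∑' x, f x = 1) : HasSum f 1 := by
  have hs : Summable f := by
    by_contra hn
    rw [tsum_eq_zero_of_not_summable hn] at h
    exact zero_ne_one h
  exact h ▸ hs.hasSum

/-- Means of finitely supported Lipschitz test functions decrease at most linearly along
solutions of the master equation. -/
lemma IsMasterSolution.sum_mul_sub_le {S : Type} [Fintype S] [DecidableEq S] {n : ℕ}
    {q : S → S → ℝ} (hq : ∀ i j : S, i ≠ j → 0 ≤ q i j)
    {v : S → S → (Fin n → ℤ)} (hv : ∀ i j, v j i = -(v i j))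
    {p : ℝ → S × (Fin n → ℤ) → ℝ} (hp : IsMasterSolution q v p)
    {g : S × (Fin n → ℤ) → ℝ} {F : Finset (S × (Fin n → ℤ))}
    (hgF : ∀ y, y ∉ F → g y = 0) {K : ℝ} (hK : 0 ≤ K)
    (hg : ∀ i j α, -K ≤ g (j, α + v i j) - g (i, α)) {t : ℝ} (ht : 0 ≤ t) :
    ∑ y ∈ F, g y * p 0 y - K * (totalRate q * Fintype.card S) * t ≤ ∑ y ∈ F, g y * p t y := by
  have hd : ∀ s, 0 ≤ s → HasDerivWithinAt (fun s => ∑ y ∈ F, g y * p s y)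
      (∑ y ∈ F, g y * mEqDeriv q v (p s) y) (Set.Ici 0) s := fun s hs =>
    HasDerivWithinAt.fun_sum fun y _ => (hp.2 y s hs).const_mul (g y)
  have hd' : ∀ s, 0 < s → HasDerivAt (fun s => ∑ y ∈ F, g y * p s y)
      (∑ y ∈ F, g y * mEqDeriv q v (p s) y) s := fun s hs =>
    (hd s hs.le).hasDerivAt (Ici_mem_nhds hs)
  have h := (convex_Ici (0 : ℝ)).mul_sub_le_image_sub_of_le_deriv
    (fun s hs => (hd s hs).continuousWithinAt)
    (fun s hs => (hd' s (by simpa using hs)).differentiableAt.differentiableWithinAt)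
    (C := -(K * (totalRate q * Fintype.card S)))
    (fun s hs => by
      have hs' : 0 < s := by simpa using hs
      rw [(hd' s hs').deriv]
      exact neg_le_sum_mul_mEqDeriv hq hv (hp.1 s hs'.le).1
        (hasSum_one_of_tsum_eq_one (hp.1 s hs'.le).2) hgF hK hg)
    0 Set.self_mem_Ici t ht ht
  linarith

lemma summable_exp_neg_abs_int {ε : ℝ} (hε : 0 < ε) :
    Summable fun k : ℤ => Real.exp (-(ε * |(k : ℝ)|)) := by
  have h : Summable fun k : ℕ => Real.exp (-(ε * (k : ℝ))) := by
    have := Real.summable_exp_nat_mul_iff.2 (neg_lt_zero.2 hε)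
    refine this.congr fun k => ?_
    congr 1
    ring
  refine Summable.of_nat_of_neg ?_ ?_ <;> simpa using h

lemma summable_exp_neg_l1 {n : ℕ} {ε : ℝ} (hε : 0 < ε) :
    Summable fun β : Fin n → ℤ => Real.exp (-(ε * ∑ k, |(β k : ℝ)|)) := by
  classical
  have h1 := summable_exp_neg_abs_int hε
  refine summable_of_sum_le (c := ∏ _k : Fin n, ∑' m : ℤ, Real.exp (-(ε * |(m : ℝ)|)))
    (fun _ => (Real.exp_pos _).le) fun u => ?_
  have hfac : ∀ β : Fin n → ℤ, Real.exp (-(ε * ∑ k, |(β k : ℝ)|))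
      = ∏ k, Real.exp (-(ε * |(β k : ℝ)|)) := fun β => by
    rw [← Real.exp_sum, Finset.mul_sum, Finset.sum_neg_distrib]
  set s : Fin n → Finset ℤ := fun k => u.image fun β => β k
  calc ∑ β ∈ u, Real.exp (-(ε * ∑ k, |(β k : ℝ)|))
      ≤ ∑ β ∈ Fintype.piFinset s,
          Real.exp (-(ε * ∑ k, |(β k : ℝ)|)) :=
        Finset.sum_le_sum_of_subset_of_nonneg
          (fun β hβ => Fintype.mem_piFinset.2 fun k => Finset.mem_image_of_mem _ hβ)
          fun _ _ _ => (Real.exp_pos _).le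
    _ = ∏ k, ∑ m ∈ s k, Real.exp (-(ε * |(m : ℝ)|)) := by
        rw [Finset.prod_univ_sum]
        exact Finset.sum_congr rfl fun β _ => hfac β
    _ ≤ ∏ _k : Fin n, ∑' m : ℤ, Real.exp (-(ε * |(m : ℝ)|)) :=
        Finset.prod_le_prod (fun _ _ => Finset.sum_nonneg fun _ _ => (Real.exp_pos _).le)
          fun _ _ => h1.sum_le_tsum _ fun _ _ => (Real.exp_pos _).le

/-- A summable weight dominating a given distribution whose logarithm varies by at most `δ`
along the edges of the lifted graph. -/
lemma exists_slowly_varying_weight {S : Type} [Fintype S] {n : ℕ}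
    (v : S → S → (Fin n → ℤ)) {r : S × (Fin n → ℤ) → ℝ} (hr0 : ∀ x, 0 ≤ r x)
    (hr : HasSum r 1) {δ : ℝ} (hδ : 0 < δ) :
    ∃ w : S × (Fin n → ℤ) → ℝ, (∀ y, 0 < w y) ∧ (∀ y, w y ≤ 1) ∧ (∀ y, r y ≤ w y) ∧
      Summable w ∧ ∀ i j α, Real.log (w (j, α + v i j)) ≤ Real.log (w (i, α)) + δ := by
  set D : ℝ := ∑ i, ∑ j, ∑ k, |(v i j k : ℝ)| with hD
  have hDij : ∀ i j, ∑ k, |(v i j k : ℝ)| ≤ D := fun i j =>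
    (Finset.single_le_sum (f := fun j => ∑ k, |(v i j k : ℝ)|)
      (fun _ _ => Finset.sum_nonneg fun _ _ => abs_nonneg _) (Finset.mem_univ j)).trans
    (Finset.single_le_sum (f := fun i => ∑ j, ∑ k, |(v i j k : ℝ)|)
      (fun _ _ => Finset.sum_nonneg fun _ _ => Finset.sum_nonneg fun _ _ => abs_nonneg _)
      (Finset.mem_univ i))
  have hD0 : 0 ≤ D := Finset.sum_nonneg fun _ _ => Finset.sum_nonneg fun _ _ =>
    Finset.sum_nonneg fun _ _ => abs_nonneg _
  obtain ⟨ε, hε, hεD⟩ : ∃ ε, 0 < ε ∧ ε * D ≤ δ := by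
    refine ⟨δ / (D + 1), by positivity, ?_⟩
    rw [div_mul_eq_mul_div, div_le_iff₀ (by positivity)]
    nlinarith
  set κ : (Fin n → ℤ) → ℝ := fun β => Real.exp (-(ε * ∑ k, |(β k : ℝ)|)) with hκ
  have hκpos : ∀ β, 0 < κ β := fun β => Real.exp_pos _
  have hκ1 : ∀ β, κ β ≤ 1 := fun β => by
    rw [hκ, Real.exp_le_one_iff, neg_nonpos]
    exact mul_nonneg hε.le (Finset.sum_nonneg fun _ _ => abs_nonneg _)
  have hκlip : ∀ i j β, κ (β + v i j) ≤ Real.exp δ * κ β := fun i j β => by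
    simp only [hκ]
    rw [← Real.exp_add, Real.exp_le_exp]
    have h1 : ∑ k, |(β k : ℝ)| ≤ ∑ k, |((β + v i j) k : ℝ)| + ∑ k, |(v i j k : ℝ)| := by
      rw [← Finset.sum_add_distrib]
      refine Finset.sum_le_sum fun k _ => ?_
      have : (β k : ℝ) = ((β + v i j) k : ℝ) - (v i j k : ℝ) := by
        simp [Pi.add_apply]
      rw [this]
      exact abs_sub _ _
    have h2 := mul_le_mul_of_nonneg_left (h1.trans (add_le_add_right (hDij i j) _)) hε.le
    rw [mul_add] at h2
    linarith
  have hκsum : ∀ x : S × (Fin n → ℤ),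
      HasSum (fun y : S × (Fin n → ℤ) => κ (y.2 - x.2)) (Fintype.card S * ∑' β, κ β) := by
    intro x
    have h0 : HasSum (fun β => κ (β - x.2)) (∑' β, κ β) :=
      (Equiv.subRight x.2).hasSum_iff.2 (summable_exp_neg_l1 hε).hasSum
    have hs : Summable (fun y : S × (Fin n → ℤ) => κ (y.2 - x.2)) :=
      (summable_prod_of_nonneg fun y => (hκpos _).le).2
        ⟨fun _ => h0.summable, (hasSum_fintype _).summable⟩
    have h1 := (hs.hasSum.prod_fiberwise fun _ => h0).unique (hasSum_fintype _)
    have h2 : ∑' y : S × (Fin n → ℤ), κ (y.2 - x.2) = Fintype.card S * ∑' β, κ β := by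
      simpa using h1
    exact h2 ▸ hs.hasSum
  obtain ⟨hfib, hw⟩ := hasSum_mixture (k := fun x y : S × (Fin n → ℤ) => κ (y.2 - x.2))
    hr0 hr (fun _ _ => (hκpos _).le) hκsum
  have hterm : ∀ y x : S × (Fin n → ℤ), 0 ≤ r x * κ (y.2 - x.2) :=
    fun y x => mul_nonneg (hr0 x) (hκpos _).le
  have hrw : ∀ y, r y ≤ ∑' x, r x * κ (y.2 - x.2) := fun y => by
    have := (hfib y).le_tsum y fun x _ => hterm y x
    simpa [hκ] using this
  have hwpos : ∀ y : S × (Fin n → ℤ), 0 < ∑' x, r x * κ (y.2 - x.2) := fun y => by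
    obtain ⟨x, hx⟩ : ∃ x, 0 < r x := by
      by_contra! h
      have hz : r = 0 := funext fun x => le_antisymm (h x) (hr0 x)
      exact one_ne_zero (hr.unique (hz ▸ hasSum_zero))
    exact (hfib y).tsum_pos (hterm y) x (mul_pos hx (hκpos _))
  refine ⟨fun y => ∑' x, r x * κ (y.2 - x.2), hwpos, fun y => ?_, hrw, hw.summable, ?_⟩
  · rw [← hr.tsum_eq]
    exact (hfib y).tsum_le_tsum (fun x => mul_le_of_le_one_right (hr0 x) (hκ1 _)) hr.summable
  · intro i j α
    have h : ∑' x, r x * κ ((j, α + v i j).2 - x.2)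
        ≤ Real.exp δ * ∑' x, r x * κ ((i, α).2 - x.2) := by
      rw [← tsum_mul_left]
      refine (hfib (j, α + v i j)).tsum_le_tsum (fun x => ?_) ((hfib (i, α)).mul_left _)
      have := mul_le_mul_of_nonneg_left (hκlip i j (α - x.2)) (hr0 x)
      rw [mul_left_comm, show (j, α + v i j).2 - x.2 = α - x.2 + v i j by
        simp only; abel]
      exact this
    have h' := Real.log_le_log (hwpos _) h
    rw [Real.log_mul (Real.exp_pos _).ne' (hwpos _).ne', Real.log_exp] at h'
    linarith

lemma hasSum_mixSol {S : Type} [Fintype S] [DecidableEq S] {n : ℕ}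
    {q : S → S → ℝ} {v : S → S → (Fin n → ℤ)}
    {P : S × (Fin n → ℤ) → ℝ → S × (Fin n → ℤ) → ℝ} (hP : ∀ x, IsMasterSolution q v (P x))
    {r : S × (Fin n → ℤ) → ℝ} (hr0 : ∀ x, 0 ≤ r x) (hr : HasSum r 1) {t : ℝ} (ht : 0 ≤ t) :
    (∀ y, Summable fun x => r x * P x t y) ∧ HasSum (mixSol P r t) 1 := by
  have := hasSum_mixture (k := fun x y => P x t y) hr0 hr (fun x => ((hP x).1 t ht).1)
    (fun x => hasSum_one_of_tsum_eq_one ((hP x).1 t ht).2)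
  rwa [one_mul] at this

lemma mixSol_nonneg {S : Type} [Fintype S] [DecidableEq S] {n : ℕ}
    {q : S → S → ℝ} {v : S → S → (Fin n → ℤ)}
    {P : S × (Fin n → ℤ) → ℝ → S × (Fin n → ℤ) → ℝ} (hP : ∀ x, IsMasterSolution q v (P x))
    {r : S × (Fin n → ℤ) → ℝ} (hr0 : ∀ x, 0 ≤ r x) {t : ℝ} (ht : 0 ≤ t)
    (y : S × (Fin n → ℤ)) : 0 ≤ mixSol P r t y :=
  tsum_nonneg fun x => mul_nonneg (hr0 x) (((hP x).1 t ht).1 y)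

/-- The cross entropy of the solution relative to a slowly varying weight dominating the
initial distribution grows at most linearly, with slope proportional to the variation. -/
lemma sum_mixSol_mul_neg_log_le {S : Type} [Fintype S] [DecidableEq S] {n : ℕ}
    {q : S → S → ℝ} (hq : ∀ i j : S, i ≠ j → 0 ≤ q i j)
    {v : S → S → (Fin n → ℤ)} (hv : ∀ i j, v j i = -(v i j))
    {P : S × (Fin n → ℤ) → ℝ → S × (Fin n → ℤ) → ℝ} (hP : IsTransitionFamily q v P)
    {r : S × (Fin n → ℤ) → ℝ} (hr0 : ∀ x, 0 ≤ r x) (hr : HasSum r 1)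
    (hrH : Summable fun x => Real.negMulLog (r x))
    {w : S × (Fin n → ℤ) → ℝ} (hw0 : ∀ y, 0 < w y) (hrw : ∀ y, r y ≤ w y)
    (hw1 : ∀ y, w y ≤ 1) (hws : Summable w) {δ : ℝ} (hδ : 0 ≤ δ)
    (hwlip : ∀ i j α, Real.log (w (j, α + v i j)) ≤ Real.log (w (i, α)) + δ)
    {t : ℝ} (ht : 0 ≤ t) (F : Finset (S × (Fin n → ℤ))) :
    ∑ y ∈ F, mixSol P r t y * (-Real.log (w y))
      ≤ ∑' x, Real.negMulLog (r x) + δ * (totalRate q * Fintype.card S) * t := by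
  set ψ : S × (Fin n → ℤ) → ℝ := fun y => -Real.log (w y) with hψ
  have hψ0 : ∀ y, 0 ≤ ψ y := fun y => neg_nonneg.2 (Real.log_nonpos (hw0 y).le (hw1 y))
  set M : ℝ := ∑ y ∈ F, ψ y with hM
  have hM0 : 0 ≤ M := Finset.sum_nonneg fun y _ => hψ0 y
  have hMF : ∀ y ∈ F, ψ y ≤ M := fun y hy => Finset.single_le_sum (fun y _ => hψ0 y) hy
  set g : S × (Fin n → ℤ) → ℝ := fun y => max (M - ψ y) 0 with hg
  have hg0 : ∀ y, 0 ≤ g y := fun y => le_max_right _ _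
  have hgM : ∀ y, g y ≤ M := fun y => max_le (by linarith [hψ0 y]) hM0
  have hgψ : ∀ y, M - g y ≤ ψ y := fun y => by linarith [le_max_left (M - ψ y) 0]
  have hfin : {y | Real.exp (-M) < w y}.Finite := by
    have := hws.tendsto_cofinite_zero.eventually (gt_mem_nhds (Real.exp_pos (-M)))
    rw [Filter.eventually_cofinite] at this
    exact this.subset fun y (hy : Real.exp (-M) < w y) => not_lt.2 hy.le
  set G : Finset (S × (Fin n → ℤ)) := hfin.toFinset with hG
  have hgG : ∀ y, y ∉ G → g y = 0 := fun y hy => by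
    have h : w y ≤ Real.exp (-M) := by simpa [hG] using hy
    have h' := Real.log_le_log (hw0 y) h
    rw [Real.log_exp] at h'
    exact max_eq_right (by simp only [hψ]; linarith)
  have hglip : ∀ i j α, -δ ≤ g (j, α + v i j) - g (i, α) := fun i j α => by
    have h := hwlip j i (α + v i j)
    rw [hv i j, add_neg_cancel_right] at h
    simp only [hg, hψ]
    rcases max_cases (M - -Real.log (w (i, α))) 0 with ⟨h1, h2⟩ | ⟨h1, h2⟩ <;> rw [h1]
    · have := le_max_left (M - -Real.log (w (j, α + v i j))) 0
      linarith
    · have := le_max_right (M - -Real.log (w (j, α + v i j))) 0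
      linarith
  set C : ℝ := δ * (totalRate q * Fintype.card S) with hC
  have hx : ∀ x, g x - C * t ≤ ∑ y ∈ G, g y * P x t y := fun x => by
    have h := (hP.1 x).sum_mul_sub_le hq hv hgG hδ hglip ht
    have h0 : ∑ y ∈ G, g y * P x 0 y = g x := by
      rw [Finset.sum_eq_single x]
      · rw [(hP.2.1 x).1, mul_one]
      · intro y _ hy
        rw [(hP.2.1 x).2 y hy, mul_zero]
      · intro hxG
        rw [hgG x hxG, zero_mul]
    rwa [h0] at h
  obtain ⟨hfib, hp⟩ := hasSum_mixSol hP.1 hr0 hr ht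
  have hp0 := mixSol_nonneg hP.1 hr0 ht
  have hrg : Summable fun x => r x * g x :=
    .of_nonneg_of_le (fun x => mul_nonneg (hr0 x) (hg0 x))
      (fun x => mul_le_mul_of_nonneg_left (hgM x) (hr0 x)) (hr.summable.mul_right M)
  have hmean : ∑' x, r x * g x - C * t ≤ ∑ y ∈ G, g y * mixSol P r t y := by
    have h1 : HasSum (fun x => ∑ y ∈ G, g y * (r x * P x t y))
        (∑ y ∈ G, g y * mixSol P r t y) :=
      hasSum_sum fun y _ => (hfib y).hasSum.mul_left (g y)
    have h2 : HasSum (fun x => r x * g x - r x * (C * t)) (∑' x, r x * g x - 1 * (C * t)) :=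
      hrg.hasSum.sub (hr.mul_right _)
    rw [one_mul] at h2
    refine hasSum_le (fun x => ?_) h2 h1
    have := mul_le_mul_of_nonneg_left (hx x) (hr0 x)
    rw [mul_sub, Finset.mul_sum] at this
    exact this.trans_eq (Finset.sum_congr rfl fun y _ => by ring)
  have hent : M - ∑' x, r x * g x ≤ ∑' x, Real.negMulLog (r x) := by
    have h1 : HasSum (fun x => r x * M - r x * g x) (1 * M - ∑' x, r x * g x) :=
      (hr.mul_right M).sub hrg.hasSum
    rw [one_mul] at h1
    refine hasSum_le (fun x => ?_) h1 hrH.hasSum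
    rcases (hr0 x).eq_or_lt with h0 | h0
    · simp [← h0]
    · rw [← mul_sub, Real.negMulLog, neg_mul, ← mul_neg]
      refine mul_le_mul_of_nonneg_left ((hgψ x).trans ?_) h0.le
      exact neg_le_neg (Real.log_le_log h0 (hrw x))
  have hpg : HasSum (fun y => mixSol P r t y * M - g y * mixSol P r t y)
      (1 * M - ∑ y ∈ G, g y * mixSol P r t y) :=
    (hp.mul_right M).sub (hasSum_sum_of_ne_finset_zero fun y hy => by rw [hgG y hy, zero_mul])
  have hF : ∑ y ∈ F, mixSol P r t y * ψ y ≤ 1 * M - ∑ y ∈ G, g y * mixSol P r t y := by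
    calc ∑ y ∈ F, mixSol P r t y * ψ y
        = ∑ y ∈ F, (mixSol P r t y * M - g y * mixSol P r t y) := by
          refine Finset.sum_congr rfl fun y hy => ?_
          have : g y = M - ψ y := max_eq_left (sub_nonneg.2 (hMF y hy))
          rw [this]
          ring
      _ ≤ _ := sum_le_hasSum F (fun y _ => by
          have := mul_le_mul_of_nonneg_left (hgM y) (hp0 y)
          linarith) hpg
  linarith

/-- Up to a sublinear error, the free energy of the lifted chain is bounded below. -/
lemma exists_freeEnergyL_ge {S : Type} [Fintype S] [DecidableEq S] {n : ℕ}
    {q : S → S → ℝ} (hq : ∀ i j : S, i ≠ j → 0 ≤ q i j)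
    {v : S → S → (Fin n → ℤ)} (hv : ∀ i j, v j i = -(v i j))
    {P : S × (Fin n → ℤ) → ℝ → S × (Fin n → ℤ) → ℝ} (hP : IsTransitionFamily q v P)
    {r : S × (Fin n → ℤ) → ℝ} (hr0 : ∀ x, 0 ≤ r x) (hr : HasSum r 1)
    (hrH : Summable fun x => Real.negMulLog (r x))
    {πb : S → ℝ} (hπ0 : ∀ i, 0 < πb i) (hπ1 : ∀ i, πb i ≤ 1)
    (hF : ∀ t : ℝ, 0 ≤ t → Summable (fun x : S × (Fin n → ℤ) =>
        mixSol P r t x * Real.log (mixSol P r t x / πb x.1)))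
    {η : ℝ} (hη : 0 < η) :
    ∃ A, ∀ t, 0 ≤ t → -(A + η * t) ≤ freeEnergyL πb (mixSol P r t) := by
  set c : ℝ := totalRate q * Fintype.card S with hc
  have hc0 : 0 ≤ c := mul_nonneg (totalRate_nonneg q) (Nat.cast_nonneg _)
  obtain ⟨δ, hδ, hδη⟩ : ∃ δ, 0 < δ ∧ δ * c ≤ η := by
    refine ⟨η / (c + 1), by positivity, ?_⟩
    rw [div_mul_eq_mul_div, div_le_iff₀ (by positivity)]
    nlinarith
  obtain ⟨w, hw0, hw1, hrw, hws, hwlip⟩ := exists_slowly_varying_weight v hr0 hr hδ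
  refine ⟨∑' x, Real.negMulLog (r x) + ∑' y, w y, fun t ht => ?_⟩
  have hp0 := mixSol_nonneg hP.1 hr0 ht
  have hterm : ∀ y, -(mixSol P r t y * (-Real.log (w y)) + w y)
      ≤ mixSol P r t y * Real.log (mixSol P r t y / πb y.1) := fun y => by
    rcases (hp0 y).eq_or_lt with h0 | h0
    · rw [← h0]
      simpa using (hw0 y).le
    · have h1 : Real.log (mixSol P r t y) ≤ Real.log (mixSol P r t y / πb y.1) :=
        Real.log_le_log h0 (le_div_self h0.le (hπ0 _) (hπ1 _))
      have h2 := Real.log_le_sub_one_of_pos (div_pos (hw0 y) h0)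
      rw [Real.log_div (hw0 y).ne' h0.ne'] at h2
      have h3 : mixSol P r t y * (w y / mixSol P r t y) = w y := by field_simp
      nlinarith
  refine le_hasSum_of_le_sum (hF t ht).hasSum fun F => ?_
  have h1 := sum_mixSol_mul_neg_log_le hq hv hP hr0 hr hrH hw0 hrw hw1 hws hδ.le hwlip ht F
  have h2 := hws.sum_le_tsum F fun y _ => (hw0 y).le
  have h3 := Finset.sum_le_sum fun y (_ : y ∈ F) => hterm y
  rw [Finset.sum_neg_distrib, Finset.sum_add_distrib] at h3
  have h4 := mul_le_mul_of_nonneg_right hδη ht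
  linarith

lemma exists_freeEnergyL_le {S : Type} [Fintype S] [DecidableEq S] {n : ℕ}
    {q : S → S → ℝ} {v : S → S → (Fin n → ℤ)}
    {P : S × (Fin n → ℤ) → ℝ → S × (Fin n → ℤ) → ℝ} (hP : ∀ x, IsMasterSolution q v (P x))
    {r : S × (Fin n → ℤ) → ℝ} (hr0 : ∀ x, 0 ≤ r x) (hr : HasSum r 1)
    {πb : S → ℝ} (hπ0 : ∀ i, 0 < πb i)
    (hF : ∀ t : ℝ, 0 ≤ t → Summable (fun x : S × (Fin n → ℤ) =>
        mixSol P r t x * Real.log (mixSol P r t x / πb x.1))) :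
    ∃ A, ∀ t, 0 ≤ t → freeEnergyL πb (mixSol P r t) ≤ A := by
  refine ⟨∑ i, |Real.log (πb i)|, fun t ht => ?_⟩
  have hp0 := mixSol_nonneg hP hr0 ht
  have hp := (hasSum_mixSol hP hr0 hr ht).2
  have h := hp.mul_right (∑ i, |Real.log (πb i)|)
  rw [one_mul] at h
  refine hasSum_le (fun y => ?_) (hF t ht).hasSum h
  rcases (hp0 y).eq_or_lt with h0 | h0
  · simp [← h0]
  · refine mul_le_mul_of_nonneg_left ?_ h0.le
    have hle : mixSol P r t y ≤ 1 := le_hasSum hp y fun z _ => hp0 z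
    rw [Real.log_div h0.ne' (hπ0 _).ne']
    have h1 := Real.log_nonpos h0.le hle
    have h2 := neg_abs_le (Real.log (πb y.1))
    have h3 := Finset.single_le_sum (f := fun i => |Real.log (πb i)|)
      (fun _ _ => abs_nonneg _) (Finset.mem_univ y.1)
    linarith

lemma IsMasterSolution.hasDerivAt {S : Type} [Fintype S] [DecidableEq S] {n : ℕ}
    {q : S → S → ℝ} {v : S → S → (Fin n → ℤ)} {p : ℝ → S × (Fin n → ℤ) → ℝ}
    (hp : IsMasterSolution q v p) (x : S × (Fin n → ℤ)) {t : ℝ} (ht : 0 < t) :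
    HasDerivAt (fun s => p s x) (mEqDeriv q v (p t) x) t :=
  (hp.2 x t ht.le).hasDerivAt (Ici_mem_nhds ht)

lemma sum_inflow_le {S : Type} [Fintype S] [DecidableEq S] {n : ℕ}
    {q : S → S → ℝ} {v : S → S → (Fin n → ℤ)} {p : S × (Fin n → ℤ) → ℝ}
    (hp0 : ∀ x, 0 ≤ p x) (z : S × (Fin n → ℤ)) :
    ∑ j ∈ Finset.univ.erase z.1, p (j, z.2 + v z.1 j) * q j z.1
      ≤ totalRate q * p z + mEqDeriv q v p z := by
  have h : ∑ j ∈ Finset.univ.erase z.1, p z * q z.1 j ≤ totalRate q * p z := by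
    rw [← Finset.mul_sum, mul_comm]
    refine mul_le_mul_of_nonneg_right ?_ (hp0 z)
    calc ∑ j ∈ Finset.univ.erase z.1, q z.1 j
        ≤ ∑ j ∈ Finset.univ.erase z.1, |q z.1 j| := Finset.sum_le_sum fun _ _ => le_abs_self _
      _ ≤ ∑ j, |q z.1 j| := Finset.sum_le_sum_of_subset_of_nonneg (Finset.subset_univ _)
          fun _ _ _ => abs_nonneg _
      _ ≤ totalRate q := sum_rate_le_totalRate q _
  rw [mEqDeriv, Finset.sum_sub_distrib]
  linarith

/-- Comparison principle: a lower bound on the inflow into `z` integrates to a lower bound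
on the probability of `z`. -/
lemma IsMasterSolution.le_exp_mul {S : Type} [Fintype S] [DecidableEq S] {n : ℕ}
    {q : S → S → ℝ} {v : S → S → (Fin n → ℤ)} {p : ℝ → S × (Fin n → ℤ) → ℝ}
    (hp : IsMasterSolution q v p) (z : S × (Fin n → ℤ)) {h h' : ℝ → ℝ}
    (hh : ∀ t, HasDerivAt h (h' t) t) (h0 : h 0 ≤ p 0 z)
    (hle : ∀ t, 0 < t → h' t ≤ Real.exp (totalRate q * t) *
      ∑ j ∈ Finset.univ.erase z.1, p t (j, z.2 + v z.1 j) * q j z.1) {t : ℝ} (ht : 0 ≤ t) :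
    h t ≤ Real.exp (totalRate q * t) * p t z := by
  have hexp : ∀ s, HasDerivAt (fun s => Real.exp (totalRate q * s))
      (Real.exp (totalRate q * s) * totalRate q) s := fun s => by
    simpa using ((hasDerivAt_id s).const_mul (totalRate q)).exp
  have hd : ∀ s, 0 < s → HasDerivAt (fun s => Real.exp (totalRate q * s) * p s z - h s)
      (Real.exp (totalRate q * s) * totalRate q * p s z
        + Real.exp (totalRate q * s) * mEqDeriv q v (p s) z - h' s) s := fun s hs =>
    ((hexp s).mul (hp.hasDerivAt z hs)).sub (hh s)
  have hcont : ContinuousOn (fun s => Real.exp (totalRate q * s) * p s z - h s) (Set.Ici 0) :=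
    fun s hs => ((hexp s).continuousAt.continuousWithinAt.mul
      (hp.2 z s hs).continuousWithinAt).sub (hh s).continuousAt.continuousWithinAt
  have key := (convex_Ici (0 : ℝ)).mul_sub_le_image_sub_of_le_deriv hcont
    (fun s hs => (hd s (by simpa using hs)).differentiableAt.differentiableWithinAt) (C := 0)
    (fun s hs => by
      have hs' : 0 < s := by simpa using hs
      rw [(hd s hs').deriv]
      have h1 := mul_le_mul_of_nonneg_left (sum_inflow_le (q := q) (v := v) (hp.1 s hs'.le).1 z)
        (Real.exp_pos (totalRate q * s)).le
      have h2 := hle s hs'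
      linarith)
    0 Set.self_mem_Ici t ht ht
  simp only [mul_zero, Real.exp_zero, one_mul, zero_mul] at key
  linarith

/-- The mass that a solution started at a point puts on each class of the folded chain is
bounded below by a power of `t` near `0`. -/
lemma IsMasterSolution.exists_pow_le {S : Type} [Fintype S] [DecidableEq S] {n : ℕ}
    {q : S → S → ℝ} (hq : ∀ i j : S, i ≠ j → 0 ≤ q i j)
    {v : S → S → (Fin n → ℤ)} (hv : ∀ i j, v j i = -(v i j))
    {p : ℝ → S × (Fin n → ℤ) → ℝ} (hp : IsMasterSolution q v p) {x : S × (Fin n → ℤ)}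
    (hx : p 0 x = 1) {i : S}
    (hi : Relation.ReflTransGen (fun a b => a ≠ b ∧ 0 < q a b) x.1 i) :
    ∃ (α : Fin n → ℤ) (m : ℕ) (c : ℝ), 0 < c ∧
      ∀ t, 0 ≤ t → c * t ^ m ≤ Real.exp (totalRate q * t) * p t (i, α) := by
  have hterm : ∀ t, 0 < t → ∀ z : S × (Fin n → ℤ), ∀ j ∈ Finset.univ.erase z.1,
      0 ≤ p t (j, z.2 + v z.1 j) * q j z.1 := fun t ht z j hj =>
    mul_nonneg ((hp.1 t ht.le).1 _) (hq _ _ (Finset.ne_of_mem_erase hj))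
  induction hi with
  | refl =>
    refine ⟨x.2, 0, 1, one_pos, fun t ht => ?_⟩
    refine hp.le_exp_mul (h := fun t => 1 * t ^ 0) (h' := fun _ => 0) x (fun t => ?_) ?_ ?_ ht
    · simpa using hasDerivAt_const t (1 : ℝ)
    · simp [hx]
    · exact fun t ht => mul_nonneg (Real.exp_pos _).le (Finset.sum_nonneg (hterm t ht x))
  | @tail i j _ hij ih =>
    obtain ⟨α, m, c, hc, ih⟩ := ih
    have hcq : 0 < c * q i j := mul_pos hc hij.2
    refine ⟨α + v i j, m + 1, c * q i j / (m + 1), by positivity, fun t ht => ?_⟩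
    refine hp.le_exp_mul (h := fun t => c * q i j / (m + 1) * t ^ (m + 1))
      (h' := fun t => c * q i j * t ^ m) (j, α + v i j) (fun t => ?_) ?_ ?_ ht
    · have := (hasDerivAt_pow (m + 1) t).const_mul (c * q i j / (m + 1))
      rw [Nat.add_sub_cancel, ← mul_assoc, Nat.cast_add_one,
        div_mul_cancel₀ _ (Nat.cast_add_one_ne_zero m)] at this
      exact this
    · simpa using (hp.1 0 le_rfl).1 _
    · intro t ht
      have h1 := mul_le_mul_of_nonneg_right (ih t ht.le) hij.2.le
      have h2 := Finset.single_le_sum (hterm t ht (j, α + v i j))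
        (Finset.mem_erase.2 ⟨hij.1, Finset.mem_univ i⟩)
      simp only [hv i j, add_neg_cancel_right] at h2
      have h3 := mul_le_mul_of_nonneg_left h2 (Real.exp_pos (totalRate q * t)).le
      simp only
      linarith

section Fold

variable {S : Type} [Fintype S] [DecidableEq S] {n : ℕ}
  {q : S → S → ℝ} {v : S → S → (Fin n → ℤ)}
  {P : S × (Fin n → ℤ) → ℝ → S × (Fin n → ℤ) → ℝ} {r : S × (Fin n → ℤ) → ℝ}

lemma hasSum_foldD_mixSol (hP : ∀ x, IsMasterSolution q v (P x)) (hr0 : ∀ x, 0 ≤ r x)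
    (hr : HasSum r 1) {t : ℝ} (ht : 0 ≤ t) :
    (∀ i, HasSum (fun α => mixSol P r t (i, α)) (foldD (mixSol P r t) i)) ∧
      HasSum (foldD (mixSol P r t)) 1 := by
  have hp := (hasSum_mixSol hP hr0 hr ht).2
  have h : ∀ i, HasSum (fun α => mixSol P r t (i, α)) (foldD (mixSol P r t) i) :=
    fun i => (hp.summable.prod_factor i).hasSum
  exact ⟨h, hp.prod_fiberwise h⟩

lemma foldD_mixSol_nonneg (hP : ∀ x, IsMasterSolution q v (P x)) (hr0 : ∀ x, 0 ≤ r x)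
    {t : ℝ} (ht : 0 ≤ t) (i : S) : 0 ≤ foldD (mixSol P r t) i :=
  tsum_nonneg fun _ => mixSol_nonneg hP hr0 ht _

lemma foldD_mixSol_le_one (hP : ∀ x, IsMasterSolution q v (P x)) (hr0 : ∀ x, 0 ≤ r x)
    (hr : HasSum r 1) {t : ℝ} (ht : 0 ≤ t) (i : S) : foldD (mixSol P r t) i ≤ 1 :=
  le_hasSum (hasSum_foldD_mixSol hP hr0 hr ht).2 i fun j _ => foldD_mixSol_nonneg hP hr0 ht j

lemma measurable_foldD_mixSol (hP : ∀ x, IsMasterSolution q v (P x)) (hr0 : ∀ x, 0 ≤ r x)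
    (hr : HasSum r 1) (i : S) :
    Measurable fun t => foldD (mixSol P r (max t 0)) i := by
  have hcont : ∀ x y, Continuous fun t : ℝ => P x (max t 0) y := fun x y => by
    have h : ContinuousOn (fun t => P x t y) (Set.Ici 0) :=
      fun t ht => ((hP x).2 y t ht).continuousWithinAt
    exact h.comp_continuous (continuous_id.max continuous_const) fun t => Set.mem_Ici.2 (le_max_right t 0)
  have hmix : ∀ y, Continuous fun t : ℝ => mixSol P r (max t 0) y := fun y => by
    refine continuous_tsum (fun x => (hcont x y).const_mul (r x)) hr.summable fun x t => ?_
    obtain ⟨h0, h1⟩ := (hP x).1 (max t 0) (le_max_right _ _)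
    rw [norm_mul, Real.norm_of_nonneg (hr0 x), Real.norm_of_nonneg (h0 y)]
    exact mul_le_of_le_one_right (hr0 x)
      (le_hasSum (hasSum_one_of_tsum_eq_one h1) y fun z _ => h0 z)
  refine measurable_of_tendsto_metrizable' (atTop : Filter (Finset (Fin n → ℤ)))
    (f := fun F t => ∑ α ∈ F, mixSol P r (max t 0) (i, α))
    (fun F => Finset.measurable_sum _ fun α _ => (hmix (i, α)).measurable) ?_
  rw [tendsto_pi_nhds]
  exact fun t => (hasSum_foldD_mixSol hP hr0 hr (le_max_right t 0)).1 i

lemma exists_pow_le_foldD (hq : ∀ i j : S, i ≠ j → 0 ≤ q i j)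
    (hconn : ∀ i j : S, Relation.ReflTransGen (fun a b => a ≠ b ∧ 0 < q a b) i j)
    (hv : ∀ i j, v j i = -(v i j)) (hP : IsTransitionFamily q v P)
    (hr0 : ∀ x, 0 ≤ r x) (hr : HasSum r 1) (i : S) :
    ∃ (m : ℕ) (c : ℝ), 0 < c ∧
      ∀ t, 0 ≤ t → c * t ^ m ≤ Real.exp (totalRate q * t) * foldD (mixSol P r t) i := by
  obtain ⟨x, hx⟩ : ∃ x, 0 < r x := by
    by_contra! h
    have hz : r = 0 := funext fun x => le_antisymm (h x) (hr0 x)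
    exact one_ne_zero (hr.unique (hz ▸ hasSum_zero))
  obtain ⟨α, m, c, hc, h⟩ := (hP.1 x).exists_pow_le hq hv (hP.2.1 x).1 (hconn x.1 i)
  refine ⟨m, r x * c, mul_pos hx hc, fun t ht => ?_⟩
  have h1 : r x * P x t (i, α) ≤ mixSol P r t (i, α) :=
    ((hasSum_mixSol hP.1 hr0 hr ht).1 (i, α)).le_tsum x
      fun y _ => mul_nonneg (hr0 y) (((hP.1 y).1 t ht).1 _)
  have h2 : mixSol P r t (i, α) ≤ foldD (mixSol P r t) i :=
    le_hasSum ((hasSum_foldD_mixSol hP.1 hr0 hr ht).1 i) α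
      fun β _ => mixSol_nonneg hP.1 hr0 ht _
  have h3 := mul_le_mul_of_nonneg_left (h1.trans h2) (Real.exp_pos (totalRate q * t)).le
  have h4 := mul_le_mul_of_nonneg_left (h t ht) hx.le
  linarith

lemma foldD_mixSol_pos (hq : ∀ i j : S, i ≠ j → 0 ≤ q i j)
    (hconn : ∀ i j : S, Relation.ReflTransGen (fun a b => a ≠ b ∧ 0 < q a b) i j)
    (hv : ∀ i j, v j i = -(v i j)) (hP : IsTransitionFamily q v P)
    (hr0 : ∀ x, 0 ≤ r x) (hr : HasSum r 1) (i : S) {t : ℝ} (ht : 0 < t) :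
    0 < foldD (mixSol P r t) i := by
  obtain ⟨m, c, hc, h⟩ := exists_pow_le_foldD hq hconn hv hP hr0 hr i
  exact pos_of_mul_pos_right ((mul_pos hc (pow_pos ht m)).trans_le (h t ht.le))
    (Real.exp_pos _).le

lemma integrableOn_log_foldD (hq : ∀ i j : S, i ≠ j → 0 ≤ q i j)
    (hconn : ∀ i j : S, Relation.ReflTransGen (fun a b => a ≠ b ∧ 0 < q a b) i j)
    (hv : ∀ i j, v j i = -(v i j)) (hP : IsTransitionFamily q v P)
    (hr0 : ∀ x, 0 ≤ r x) (hr : HasSum r 1) (i : S) {T : ℝ} (hT : 0 < T) :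
    IntegrableOn (fun t => Real.log (foldD (mixSol P r t) i)) (Set.Ioc 0 T) := by
  obtain ⟨m, c, hc, h⟩ := exists_pow_le_foldD hq hconn hv hP hr0 hr i
  have hbound : IntegrableOn
      (fun t => |Real.log c| + m * |Real.log t| + totalRate q * t) (Set.Ioc 0 T) := by
    rw [← intervalIntegrable_iff_integrableOn_Ioc_of_le hT.le]
    exact (intervalIntegrable_const.add
      ((intervalIntegral.intervalIntegrable_log').abs.const_mul _)).add
      (intervalIntegral.intervalIntegrable_id.const_mul _)
  refine Integrable.mono' hbound ?_ ?_
  · refine AEStronglyMeasurable.congr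
      (measurable_foldD_mixSol hP.1 hr0 hr i).log.aestronglyMeasurable ?_
    filter_upwards [ae_restrict_mem measurableSet_Ioc] with t ht
    rw [max_eq_left ht.1.le]
  · filter_upwards [ae_restrict_mem measurableSet_Ioc] with t ht
    have hpos := foldD_mixSol_pos hq hconn hv hP hr0 hr i ht.1
    have h1 := Real.log_nonpos hpos.le (foldD_mixSol_le_one hP.1 hr0 hr ht.1.le i)
    have h2 := Real.log_le_log (mul_pos hc (pow_pos ht.1 m)) (h t ht.1.le)
    rw [Real.log_mul hc.ne' (pow_pos ht.1 m).ne', Real.log_pow,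
      Real.log_mul (Real.exp_pos _).ne' hpos.ne', Real.log_exp] at h2
    rw [Real.norm_eq_abs, abs_of_nonpos h1]
    have h3 := neg_abs_le (Real.log c)
    have h4 := mul_le_mul_of_nonneg_left (neg_abs_le (Real.log t)) (Nat.cast_nonneg (α := ℝ) m)
    linarith

/-- The entropy production rate of the folded chain is locally integrable, including at `0`. -/
lemma intervalIntegrable_epBar (hq : ∀ i j : S, i ≠ j → 0 ≤ q i j)
    (hsym : ∀ i j : S, i ≠ j → (0 < q i j ↔ 0 < q j i))
    (hconn : ∀ i j : S, Relation.ReflTransGen (fun a b => a ≠ b ∧ 0 < q a b) i j)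
    (hv : ∀ i j, v j i = -(v i j)) (hP : IsTransitionFamily q v P)
    (hr0 : ∀ x, 0 ≤ r x) (hr : HasSum r 1) {T : ℝ} (hT : 0 < T) :
    IntervalIntegrable (fun t => epBar q (foldD (mixSol P r t))) volume 0 T := by
  rw [intervalIntegrable_iff_integrableOn_Ioc_of_le hT.le]
  refine Integrable.const_mul (integrable_finsetSum _ fun i _ =>
    integrable_finsetSum _ fun j hj => ?_) _
  have hij : i ≠ j := (Finset.ne_of_mem_erase hj).symm
  rcases (hq i j hij).eq_or_lt with h0 | h0
  · simp [← h0]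
  have h0' := (hsym i j hij).1 h0
  have hlog := ((integrableOn_log_foldD hq hconn hv hP hr0 hr i hT).sub
    (integrableOn_log_foldD hq hconn hv hP hr0 hr j hT)).add
      (integrable_const (Real.log (q i j) - Real.log (q j i)))
  have hmeas : ∀ k, AEStronglyMeasurable (fun t => foldD (mixSol P r t) k)
      (volume.restrict (Set.Ioc 0 T)) := fun k => by
    refine (measurable_foldD_mixSol hP.1 hr0 hr k).aestronglyMeasurable.congr ?_
    filter_upwards [ae_restrict_mem measurableSet_Ioc] with t ht
    rw [max_eq_left ht.1.le]
  refine (hlog.bdd_mul (c := q i j + q j i)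
    (((hmeas i).mul_const (q i j)).sub ((hmeas j).mul_const (q j i))) ?_).congr ?_
  · filter_upwards [ae_restrict_mem measurableSet_Ioc] with t ht
    have h1 := mul_le_of_le_one_left h0.le (foldD_mixSol_le_one hP.1 hr0 hr ht.1.le i)
    have h2 := mul_le_of_le_one_left h0'.le (foldD_mixSol_le_one hP.1 hr0 hr ht.1.le j)
    have h3 := mul_nonneg (foldD_mixSol_nonneg hP.1 hr0 ht.1.le i) h0.le
    have h4 := mul_nonneg (foldD_mixSol_nonneg hP.1 hr0 ht.1.le j) h0'.le
    rw [Real.norm_eq_abs, Pi.sub_apply, abs_le]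
    constructor <;> linarith
  · filter_upwards [ae_restrict_mem measurableSet_Ioc] with t ht
    have hi := foldD_mixSol_pos hq hconn hv hP hr0 hr i ht.1
    have hj := foldD_mixSol_pos hq hconn hv hP hr0 hr j ht.1
    simp only [Pi.sub_apply, Pi.add_apply]
    rw [Real.log_div (mul_pos hi h0).ne' (mul_pos hj h0').ne', Real.log_mul hi.ne' h0.ne',
      Real.log_mul hj.ne' h0'.ne']
    ring

end Fold

lemma tendsto_epBar {S : Type} {ι : Type*} [Fintype S] [DecidableEq S] {q : S → S → ℝ}
    (hq : ∀ i j : S, i ≠ j → 0 ≤ q i j)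
    (hsym : ∀ i j : S, i ≠ j → (0 < q i j ↔ 0 < q j i)) {l : Filter ι} {g : ι → S → ℝ}
    {πb : S → ℝ} (hπ : ∀ i, 0 < πb i) (hg : ∀ i, Tendsto (fun t => g t i) l (nhds (πb i))) :
    Tendsto (fun t => epBar q (g t)) l (nhds (epBar q πb)) := by
  refine (tendsto_finsetSum _ fun i _ => tendsto_finsetSum _ fun j hj => ?_).const_mul _
  have hij : i ≠ j := (Finset.ne_of_mem_erase hj).symm
  rcases (hq i j hij).eq_or_lt with h0 | h0
  · simpa [← h0] using tendsto_const_nhds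
  have h0' := (hsym i j hij).1 h0
  have hi := (hg i).mul_const (q i j)
  have hj := (hg j).mul_const (q j i)
  have hπi := mul_pos (hπ i) h0
  have hπj := mul_pos (hπ j) h0'
  exact (hi.sub hj).mul ((hi.div hj hπj.ne').log (div_pos hπi hπj).ne')

lemma tendsto_freeEnergyBar {S : Type} {ι : Type*} [Fintype S] {l : Filter ι} {g : ι → S → ℝ}
    {πb : S → ℝ} (hπ : ∀ i, 0 < πb i) (hg : ∀ i, Tendsto (fun t => g t i) l (nhds (πb i))) :
    Tendsto (fun t => freeEnergyBar πb (g t)) l (nhds (freeEnergyBar πb πb)) :=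
  tendsto_finsetSum _ fun i _ => (hg i).mul
    (((hg i).div_const _).log (div_pos (hπ i) (hπ i)).ne')

/-- Continuous-time Cesàro averages of a convergent function converge to the same limit. -/
lemma tendsto_cesaro_integral {f : ℝ → ℝ} {L : ℝ}
    (hf : ∀ T, 0 < T → IntervalIntegrable f volume 0 T) (hL : Tendsto f atTop (nhds L)) :
    Tendsto (fun T : ℝ => (1 / T) * ∫ t in (0:ℝ)..T, f t) atTop (nhds L) := by
  rw [Metric.tendsto_atTop]
  intro ε hε
  obtain ⟨N, hN⟩ := Metric.tendsto_atTop.1 hL (ε / 2) (half_pos hε)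
  set a : ℝ := max N 1 with ha
  have ha0 : 0 < a := zero_lt_one.trans_le (le_max_right _ _)
  set C : ℝ := |∫ t in (0:ℝ)..a, (f t - L)| with hC
  refine ⟨max a (2 * C / ε + 1), fun T hT => ?_⟩
  have haT : a ≤ T := (le_max_left _ _).trans hT
  have hT0 : 0 < T := ha0.trans_le haT
  have hCT : C < ε / 2 * T := by
    have h1 : 2 * C / ε < T := (lt_add_one _).trans_le ((le_max_right _ _).trans hT)
    rw [div_lt_iff₀ hε] at h1
    linarith
  have hi : ∀ T, 0 < T → IntervalIntegrable (fun t => f t - L) volume 0 T :=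
    fun T hT => (hf T hT).sub intervalIntegrable_const
  have hsplit : ∫ t in (0:ℝ)..T, (f t - L)
      = (∫ t in (0:ℝ)..a, (f t - L)) + ∫ t in a..T, (f t - L) :=
    (intervalIntegral.integral_add_adjacent_intervals (hi a ha0)
      ((hi a ha0).symm.trans (hi T hT0))).symm
  have htail : ‖∫ t in a..T, (f t - L)‖ ≤ ε / 2 * |T - a| := by
    refine intervalIntegral.norm_integral_le_of_norm_le_const fun t ht => ?_
    rw [Set.uIoc_of_le haT] at ht
    have := hN t ((le_max_left _ _).trans ht.1.le)
    rw [Real.dist_eq] at this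
    exact this.le
  have hsub : ∫ t in (0:ℝ)..T, (f t - L) = (∫ t in (0:ℝ)..T, f t) - T * L := by
    rw [intervalIntegral.integral_sub (hf T hT0) intervalIntegrable_const]
    simp
  have heq : (1 / T) * (∫ t in (0:ℝ)..T, f t) - L = (∫ t in (0:ℝ)..T, (f t - L)) / T := by
    rw [hsub]
    field_simp
  rw [Real.dist_eq, heq, abs_div, abs_of_pos hT0, div_lt_iff₀ hT0, hsplit]
  rw [Real.norm_eq_abs, abs_of_nonneg (sub_nonneg.2 haT)] at htail
  have h1 := abs_add_le (∫ t in (0:ℝ)..a, (f t - L)) (∫ t in a..T, (f t - L))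
  have h2 : 0 < ε / 2 * a := mul_pos (half_pos hε) ha0
  nlinarith

/-- A function bounded above whose negative part grows sublinearly is `o(T)`. -/
lemma tendsto_one_div_mul_zero {F : ℝ → ℝ} (hub : ∃ A, ∀ t, 0 ≤ t → F t ≤ A)
    (hlb : ∀ η, 0 < η → ∃ A, ∀ t, 0 ≤ t → -(A + η * t) ≤ F t) :
    Tendsto (fun T : ℝ => (1 / T) * F T) atTop (nhds 0) := by
  rw [Metric.tendsto_atTop]
  intro ε hε
  obtain ⟨A, hA⟩ := hub
  obtain ⟨B, hB⟩ := hlb (ε / 2) (half_pos hε)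
  refine ⟨max 1 (2 * max A B / ε + 1), fun T hT => ?_⟩
  have hT0 : 0 < T := zero_lt_one.trans_le ((le_max_left _ _).trans hT)
  have h1 : 2 * max A B / ε < T := (lt_add_one _).trans_le ((le_max_right _ _).trans hT)
  rw [div_lt_iff₀ hε] at h1
  have h2 := hA T hT0.le
  have h3 := hB T hT0.le
  have h4 := le_max_left A B
  have h5 := le_max_right A B
  have h6 := mul_pos hε hT0
  rw [Real.dist_eq, sub_zero, one_div_mul_eq_div, abs_div, abs_of_pos hT0, div_lt_iff₀ hT0,
    abs_lt]
  constructor <;> linarith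

theorem stmt_3 {S : Type} [Fintype S] [DecidableEq S] (hS : 2 ≤ Fintype.card S) {n : ℕ}
    (q : S → S → ℝ)
    (hq_nonneg : ∀ i j : S, i ≠ j → 0 ≤ q i j)
    (hq_sym : ∀ i j : S, i ≠ j → (0 < q i j ↔ 0 < q j i))
    (hq_conn : ∀ i j : S, Relation.ReflTransGen (fun a b => a ≠ b ∧ 0 < q a b) i j)
    (πb : S → ℝ) (hπpos : ∀ i, 0 < πb i) (hπsum : ∑ i, πb i = 1)
    (hπstat : ∀ j : S,
      ∑ i ∈ Finset.univ.erase j, (πb i * q i j - πb j * q j i) = 0)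
    (v : S → S → (Fin n → ℤ)) (hv : ∀ i j, v j i = -(v i j))
    (P : S × (Fin n → ℤ) → ℝ → S × (Fin n → ℤ) → ℝ)
    (hP : IsTransitionFamily q v P)
    -- r is a probability distribution with finite entropy:
    (r : S × (Fin n → ℤ) → ℝ) (hr0 : ∀ x, 0 ≤ r x) (hr1 : (∑' x, r x) = 1)
    (hrH : Summable (fun x => Real.negMulLog (r x)))
    -- (i) for every t ≥ 0 the free energy is finite and e_p(t) is finite
    --     and locally integrable:
    (hFfin : ∀ t : ℝ, 0 ≤ t →
      Summable (fun x : S × (Fin n → ℤ) =>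
        mixSol P r t x * Real.log (mixSol P r t x / πb x.1)))
    (hepfin : ∀ t : ℝ, 0 ≤ t →
      Summable (fun x : S × (Fin n → ℤ) =>
        ∑ j ∈ Finset.univ.erase x.1,
          (mixSol P r t x * q x.1 j - mixSol P r t (j, x.2 + v x.1 j) * q j x.1) *
            Real.log ((mixSol P r t x * q x.1 j) /
              (mixSol P r t (j, x.2 + v x.1 j) * q j x.1))))
    (heploc : ∀ T : ℝ, 0 < T →
      IntervalIntegrable (fun t => epL q v (mixSol P r t)) volume 0 T)
    -- (ii) the free-energy balance identity:
    (hbalance : ∀ T : ℝ, 0 < T →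
      freeEnergyL πb (mixSol P r T) - freeEnergyL πb (mixSol P r 0)
          + ∫ t in (0:ℝ)..T, epL q v (mixSol P r t)
        = freeEnergyBar πb (foldD (mixSol P r T)) - freeEnergyBar πb (foldD (mixSol P r 0))
          + ∫ t in (0:ℝ)..T, epBar q (foldD (mixSol P r t)))
    -- (iii) the folded distribution converges pointwise to π̄:
    (hfold : ∀ i : S, Tendsto (fun t => foldD (mixSol P r t) i) atTop (nhds (πb i))) :
    -- e_p converges to ē_p in Cesàro's sense:
    Tendsto (fun T : ℝ => (1 / T) * ∫ t in (0:ℝ)..T, epL q v (mixSol P r t))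
      atTop (nhds (epBar q πb)) := by
  have hr : HasSum r 1 := hasSum_one_of_tsum_eq_one hr1
  have hπ1 : ∀ i, πb i ≤ 1 := fun i =>
    hπsum ▸ Finset.single_le_sum (fun j _ => (hπpos j).le) (Finset.mem_univ i)
  have hL := tendsto_one_div_mul_zero (F := fun t => freeEnergyL πb (mixSol P r t))
    (exists_freeEnergyL_le hP.1 hr0 hr hπpos hFfin)
    fun η hη => exists_freeEnergyL_ge hq_nonneg hv hP hr0 hr hrH hπpos hπ1 hFfin hη
  have hinv : Tendsto (fun T : ℝ => 1 / T) atTop (nhds 0) := by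
    simpa using tendsto_inv_atTop_zero (𝕜 := ℝ)
  have hB := hinv.mul ((tendsto_freeEnergyBar hπpos hfold).sub_const
    (freeEnergyBar πb (foldD (mixSol P r 0)) - freeEnergyL πb (mixSol P r 0)))
  have hE := tendsto_cesaro_integral
    (fun T hT => intervalIntegrable_epBar hq_nonneg hq_sym hq_conn hv hP hr0 hr hT)
    (tendsto_epBar hq_nonneg hq_sym hπpos hfold)
  have h := (hB.add hE).sub hL
  rw [zero_mul, zero_add, sub_zero] at h
  refine h.congr' ?_
  filter_upwards [eventually_gt_atTop 0] with T hT
  linear_combination (-(1 / T)) * hbalance T hT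

end
end

section
/- Let p be a solution of the master equation of the lifted chain L whose initial distribution p(0) is the point mass at a single state (i₀,α₀) ∈ S × ℤ^n. Then there exist a constant C > 0 (depending only on S, q, n and v) and a time T₀ ≥ 2 such that H[p(t)] ≤ C·log t for all t ≥ T₀. -/
open Filter
open scoped ENNReal

noncomputable section

/-- Entropy (with values in `[0,∞]`) of a distribution on a countable set. -/
def HentE {X : Type*} (r : X → ℝ) : ℝ≥0∞ :=
  ∑' x, ENNReal.ofReal (Real.negMulLog (r x))

open Real in
theorem Real.negMulLog_le_mul_neg_log_add {p w : ℝ} (hp : 0 ≤ p) (hw : 0 < w) :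
    negMulLog p ≤ p * (-log w) + w := by
  rcases hp.eq_or_lt with rfl | hp
  · simpa using hw.le
  · have h := log_le_sub_one_of_pos (div_pos hw hp)
    rw [log_div hw.ne' hp.ne'] at h
    have h2 := mul_le_mul_of_nonneg_left h hp.le
    have h3 : p * (w / p - 1) = w - p := by field_simp
    rw [h3] at h2
    unfold negMulLog
    nlinarith

/-- The tangent line of `log` at `1 + t` lies above the graph. -/
theorem Real.log_one_add_le {a t : ℝ} (ha : 0 ≤ a) (ht : 0 ≤ t) :
    Real.log (1 + a) ≤ Real.log (1 + t) + a / (1 + t) := by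
  have h1 : 0 < 1 + a := by linarith
  have h2 : 0 < 1 + t := by linarith
  have h := Real.log_le_sub_one_of_pos (div_pos h1 h2)
  rw [Real.log_div h1.ne' h2.ne', add_div] at h
  have h3 : 1 / (1 + t) ≤ 1 := by rw [div_le_one h2]; linarith
  linarith

theorem summable_inv_one_add_abs_int_sq : Summable fun k : ℤ => ((1 + |(k : ℝ)|) ^ 2)⁻¹ := by
  have h : Summable fun k : ℕ => ((1 + (k : ℝ)) ^ 2)⁻¹ := by
    have := (summable_nat_add_iff 1).2 (Real.summable_nat_pow_inv.2 one_lt_two)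
    simpa [add_comm] using this
  refine Summable.of_nat_of_neg ?_ ?_ <;> simpa using h

theorem summable_prod_pi_of_nonneg {f : ℤ → ℝ} (hf : 0 ≤ f) (hs : Summable f) (n : ℕ) :
    Summable fun b : Fin n → ℤ => ∏ k, f (b k) := by
  induction n with
  | zero => exact Summable.of_finite
  | succ n ih =>
    rw [← (Fin.consEquiv fun _ : Fin (n + 1) => ℤ).summable_iff]
    refine (hs.mul_of_nonneg ih hf fun b => Finset.prod_nonneg fun k _ => hf _).congr fun x => ?_
    simp [Fin.prod_univ_succ, Fin.consEquiv]

/-- A summable positive weight on `ℤⁿ` with polynomial decay. -/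
def polyWeight {n : ℕ} (b : Fin n → ℤ) : ℝ := ∏ k, ((1 + |(b k : ℝ)|) ^ 2)⁻¹

theorem polyWeight_pos {n : ℕ} (b : Fin n → ℤ) : 0 < polyWeight b :=
  Finset.prod_pos fun k _ => by positivity

theorem summable_polyWeight (n : ℕ) : Summable (polyWeight (n := n)) :=
  summable_prod_pi_of_nonneg (fun k => by positivity) summable_inv_one_add_abs_int_sq n

theorem neg_log_polyWeight_le {n : ℕ} (b : Fin n → ℤ) :
    -Real.log (polyWeight b) ≤ 2 * n * Real.log (1 + ‖b‖) := by
  unfold polyWeight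
  rw [Real.log_prod (fun k _ => by positivity), ← Finset.sum_neg_distrib]
  calc ∑ k, -Real.log ((1 + |(b k : ℝ)|) ^ 2)⁻¹ ≤ ∑ _k : Fin n, 2 * Real.log (1 + ‖b‖) := by
        refine Finset.sum_le_sum fun k _ => ?_
        rw [Real.log_inv, Real.log_pow, neg_neg]
        have : |(b k : ℝ)| ≤ ‖b‖ := by
          simpa [Int.norm_eq_abs] using norm_le_pi_norm b k
        have h2 : Real.log (1 + |(b k : ℝ)|) ≤ Real.log (1 + ‖b‖) :=
          Real.log_le_log (by positivity) (by linarith)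
        push_cast
        linarith
    _ = 2 * n * Real.log (1 + ‖b‖) := by simp; ring

theorem tsum_prod_fintype_left {S B : Type*} [Fintype S] {f : S × B → ℝ} (hf : Summable f) :
    ∑' x, f x = ∑ i, ∑' b, f (i, b) := by
  rw [hf.tsum_prod, tsum_fintype]

section MasterEquation

variable {S : Type} [Fintype S] [DecidableEq S] {n : ℕ}

theorem IsMasterSolution.summable {q : S → S → ℝ} {v : S → S → (Fin n → ℤ)}
    {p : ℝ → S × (Fin n → ℤ) → ℝ} (hp : IsMasterSolution q v p) {t : ℝ} (ht : 0 ≤ t) :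
    Summable (p t) := by
  by_contra h
  have := (hp.1 t ht).2
  rw [tsum_eq_zero_of_not_summable h] at this
  exact zero_ne_one this

/-- Bound on the drift of a 1-Lipschitz function of the second coordinate. -/
def driftBound (q : S → S → ℝ) (v : S → S → (Fin n → ℤ)) : ℝ :=
  ∑ i, ∑ j ∈ Finset.univ.erase i, q j i * ‖v i j‖

/-- The cone of height `R` over a ball of radius `R` around `a`. -/
def cone (R : ℝ) (a b : Fin n → ℤ) : ℝ := max (R - ‖b - a‖) 0

theorem cone_nonneg (R : ℝ) (a b : Fin n → ℤ) : 0 ≤ cone R a b := le_max_right _ _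

theorem cone_le {R : ℝ} (hR : 0 ≤ R) (a b : Fin n → ℤ) : cone R a b ≤ R :=
  max_le (by linarith [norm_nonneg (b - a)]) hR

theorem cone_sub_norm_le (R : ℝ) (a b u : Fin n → ℤ) : cone R a b - ‖u‖ ≤ cone R a (b - u) := by
  unfold cone
  have h : ‖b - u - a‖ ≤ ‖b - a‖ + ‖u‖ := by
    rw [sub_right_comm]; exact norm_sub_le _ _
  have h2 := norm_nonneg u
  rw [sub_le_iff_le_add]
  refine max_le ?_ ?_
  · linarith [le_max_left (R - ‖b - u - a‖) 0]
  · linarith [le_max_right (R - ‖b - u - a‖) 0]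

theorem exists_finset_cone_eq_zero (R : ℝ) (a : Fin n → ℤ) :
    ∃ B : Finset (Fin n → ℤ), ∀ b ∉ B, cone R a b = 0 := by
  have hfin : (Metric.closedBall a R).Finite :=
    (isCompact_closedBall a R).finite_of_discrete
  refine ⟨hfin.toFinset, fun b hb => ?_⟩
  have : R < ‖b - a‖ := by simpa [dist_eq_norm] using hb
  exact max_eq_right (by linarith)

theorem neg_driftBound_le_sum_cone {q : S → S → ℝ} (hq_nonneg : ∀ i j : S, i ≠ j → 0 ≤ q i j)
    (v : S → S → (Fin n → ℤ)) {f : S × (Fin n → ℤ) → ℝ} (hf : ∀ x, 0 ≤ f x)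
    (hs : Summable f) (hsum : ∑' x, f x = 1) {R : ℝ} {a : Fin n → ℤ}
    {B : Finset (Fin n → ℤ)} (hB : ∀ b ∉ B, cone R a b = 0) :
    -driftBound q v ≤ ∑ i, ∑ b ∈ B, cone R a b * mEqDeriv q v f (i, b) := by
  have hsi : ∀ i, Summable fun b => f (i, b) := fun i => hs.prod_factor i
  have hone : ∀ i, ∑' b, f (i, b) ≤ 1 := fun i => by
    rw [← hsum, tsum_prod_fintype_left hs]
    exact Finset.single_le_sum (f := fun i => ∑' b, f (i, b))
      (fun j _ => tsum_nonneg fun b => hf _) (Finset.mem_univ i)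
  have hφ : ∀ (i : S), Summable fun b => cone R a b * f (i, b) := fun i =>
    summable_of_ne_finset_zero (s := B) fun b hb => by rw [hB b hb, zero_mul]
  have hkey : ∀ i j, (∑' b, cone R a b * f (j, b)) - ‖v i j‖ ≤
      ∑ b ∈ B, cone R a b * f (j, b + v i j) := fun i j => by
    have hsh : Summable fun b => cone R a b * f (j, b + v i j) :=
      summable_of_ne_finset_zero (s := B) fun b hb => by rw [hB b hb, zero_mul]
    have hsh' : Summable fun b => cone R a (b - v i j) * f (j, b) := by
      rw [← (Equiv.addRight (v i j)).summable_iff]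
      simpa [Function.comp_def] using hsh
    have e : ∑ b ∈ B, cone R a b * f (j, b + v i j) = ∑' b, cone R a (b - v i j) * f (j, b) := by
      rw [← (Equiv.addRight (v i j)).tsum_eq fun b => cone R a (b - v i j) * f (j, b)]
      simp only [Equiv.coe_addRight, add_sub_cancel_right]
      exact (tsum_eq_sum fun b hb => by rw [hB b hb, zero_mul]).symm
    rw [e]
    have h1 : ‖v i j‖ * ∑' b, f (j, b) ≤ ‖v i j‖ :=
      mul_le_of_le_one_right (norm_nonneg _) (hone j)
    rw [← tsum_mul_left] at h1
    have h2 : ∑' b, (cone R a b * f (j, b) - ‖v i j‖ * f (j, b)) ≤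
        ∑' b, cone R a (b - v i j) * f (j, b) := by
      refine ((hφ j).sub ((hsi j).mul_left _)).tsum_le_tsum (fun b => ?_) hsh'
      rw [← sub_mul]
      exact mul_le_mul_of_nonneg_right (cone_sub_norm_le R a b _) (hf _)
    rw [(hφ j).tsum_sub ((hsi j).mul_left _)] at h2
    linarith
  set m : S → ℝ := fun i => ∑' b, cone R a b * f (i, b) with hm
  have hmB : ∀ i, ∑ b ∈ B, cone R a b * f (i, b) = m i := fun i =>
    (tsum_eq_sum fun b hb => by rw [hB b hb, zero_mul]).symm
  have hrow : ∀ i, ∑ b ∈ B, cone R a b * mEqDeriv q v f (i, b) =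
      ∑ j ∈ Finset.univ.erase i,
        (q j i * (∑ b ∈ B, cone R a b * f (j, b + v i j)) - q i j * m i) := fun i => by
    simp only [mEqDeriv, Finset.mul_sum, ← hmB]
    rw [Finset.sum_comm]
    refine Finset.sum_congr rfl fun j _ => ?_
    rw [← Finset.sum_sub_distrib]
    exact Finset.sum_congr rfl fun b _ => by ring
  have hswap : ∑ i, ∑ j ∈ Finset.univ.erase i, q i j * m i =
      ∑ i, ∑ j ∈ Finset.univ.erase i, q j i * m j :=
    Finset.sum_comm' fun i j => by simp [ne_comm]
  calc -driftBound q v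
      = ∑ i, ∑ j ∈ Finset.univ.erase i, (q j i * (m j - ‖v i j‖) - q i j * m i) := by
        simp only [Finset.sum_sub_distrib, mul_sub, hswap, driftBound]; ring
    _ ≤ _ := by
        refine Finset.sum_le_sum fun i _ => ?_
        rw [hrow]
        refine Finset.sum_le_sum fun j hj => ?_
        exact sub_le_sub_right (mul_le_mul_of_nonneg_left (hkey i j)
          (hq_nonneg j i (Finset.ne_of_mem_erase hj))) _

theorem driftBound_nonneg {q : S → S → ℝ} (hq_nonneg : ∀ i j : S, i ≠ j → 0 ≤ q i j)
    (v : S → S → (Fin n → ℤ)) : 0 ≤ driftBound q v :=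
  Finset.sum_nonneg fun i _ => Finset.sum_nonneg fun j hj =>
    mul_nonneg (hq_nonneg j i (Finset.ne_of_mem_erase hj)) (norm_nonneg _)

/-- The mean displacement of a solution started at a point mass grows at most linearly. -/
theorem IsMasterSolution.sum_mul_norm_le {q : S → S → ℝ}
    (hq_nonneg : ∀ i j : S, i ≠ j → 0 ≤ q i j) {v : S → S → (Fin n → ℤ)}
    {p : ℝ → S × (Fin n → ℤ) → ℝ} (hp : IsMasterSolution q v p) {x₀ : S × (Fin n → ℤ)}
    (h₀ : p 0 x₀ = 1) {t : ℝ} (ht : 0 ≤ t) (F : Finset (S × (Fin n → ℤ))) :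
    ∑ x ∈ F, p t x * ‖x.2 - x₀.2‖ ≤ driftBound q v * t := by
  obtain ⟨R, hR0, hR⟩ : ∃ R : ℝ, 0 ≤ R ∧ ∀ x ∈ F, ‖x.2 - x₀.2‖ ≤ R :=
    ⟨∑ x ∈ F, ‖x.2 - x₀.2‖, Finset.sum_nonneg fun _ _ => norm_nonneg _, fun x hx =>
      Finset.single_le_sum (f := fun x : S × (Fin n → ℤ) => ‖x.2 - x₀.2‖)
        (fun _ _ => norm_nonneg _) hx⟩
  obtain ⟨B, hB⟩ := exists_finset_cone_eq_zero R x₀.2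
  set G : ℝ → ℝ := fun s => ∑ i, ∑ b ∈ B, cone R x₀.2 b * p s (i, b) with hG
  have hGt : ∀ s, G s = ∑' x, cone R x₀.2 x.2 * p s x := fun s => by
    rw [tsum_eq_sum (s := Finset.univ ×ˢ B) (fun x hx => by
      rw [hB x.2 (by simpa using hx), zero_mul]), Finset.sum_product]
  have hsφ : ∀ s, Summable fun x : S × (Fin n → ℤ) => cone R x₀.2 x.2 * p s x := fun s =>
    summable_of_ne_finset_zero (s := Finset.univ ×ˢ B) (fun x hx => by
      rw [hB x.2 (by simpa using hx), zero_mul])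
  have hderiv : ∀ s, 0 ≤ s → HasDerivWithinAt (fun s => G s + driftBound q v * s)
      ((∑ i, ∑ b ∈ B, cone R x₀.2 b * mEqDeriv q v (p s) (i, b)) + driftBound q v)
      (Set.Ici 0) s := fun s hs => by
    refine HasDerivWithinAt.add ?_ (by simpa using (hasDerivWithinAt_id s _).const_mul _)
    exact HasDerivWithinAt.fun_sum fun i _ => HasDerivWithinAt.fun_sum fun b _ =>
      (hp.2 (i, b) s hs).const_mul _
  have hmono : MonotoneOn (fun s => G s + driftBound q v * s) (Set.Ici 0) := by
    refine monotoneOn_of_hasDerivWithinAt_nonneg (convex_Ici 0)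
      (fun s hs => (hderiv s hs).continuousWithinAt)
      (fun s hs => (hderiv s (interior_subset hs)).mono interior_subset) fun s hs => ?_
    have hs : 0 ≤ s := interior_subset (s := Set.Ici (0 : ℝ)) hs
    have := neg_driftBound_le_sum_cone hq_nonneg v (hp.1 s hs).1 (hp.summable hs)
      (hp.1 s hs).2 hB
    linarith
  have h1 : G 0 ≤ G t + driftBound q v * t := by
    simpa using hmono Set.self_mem_Ici ht ht
  have h2 : R ≤ G 0 := by
    rw [hGt]
    have h := (hsφ 0).le_tsum x₀ fun x _ =>
      mul_nonneg (cone_nonneg _ _ _) ((hp.1 0 le_rfl).1 x)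
    simpa [h₀, cone, hR0] using h
  have hsub : ∑' x, (R - cone R x₀.2 x.2) * p t x = R - G t := by
    simp only [sub_mul]
    rw [((hp.summable ht).mul_left R).tsum_sub (hsφ t), tsum_mul_left, (hp.1 t ht).2, hGt, mul_one]
  have hssub : Summable fun x : S × (Fin n → ℤ) => (R - cone R x₀.2 x.2) * p t x := by
    simp only [sub_mul]
    exact ((hp.summable ht).mul_left R).sub (hsφ t)
  calc ∑ x ∈ F, p t x * ‖x.2 - x₀.2‖ = ∑ x ∈ F, (R - cone R x₀.2 x.2) * p t x := by
        refine Finset.sum_congr rfl fun x hx => ?_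
        rw [cone, max_eq_left (by linarith [hR x hx])]; ring
    _ ≤ R - G t := by
        rw [← hsub]
        exact hssub.sum_le_tsum F fun x _ =>
          mul_nonneg (by linarith [cone_le hR0 x₀.2 x.2]) ((hp.1 t ht).1 x)
    _ ≤ driftBound q v * t := by linarith

end MasterEquation

theorem hasSum_polyWeight_sub {S : Type*} [Fintype S] {n : ℕ} (a : Fin n → ℤ) :
    HasSum (fun x : S × (Fin n → ℤ) => polyWeight (x.2 - a))
      (Fintype.card S * ∑' b : Fin n → ℤ, polyWeight b) := by
  have hwshift : Summable fun b : Fin n → ℤ => polyWeight (b - a) :=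
    (summable_polyWeight n).comp_injective (Equiv.subRight a).injective
  have hw : Summable fun x : S × (Fin n → ℤ) => polyWeight (x.2 - a) :=
    (summable_prod_of_nonneg fun x => (polyWeight_pos _).le).2
      ⟨fun _ => hwshift, Summable.of_finite⟩
  convert hw.hasSum using 1
  rw [tsum_prod_fintype_left hw, ← (Equiv.subRight a).tsum_eq (polyWeight (n := n))]
  simp

/-- Entropy bound in terms of the mean displacement, for any reference scale `t`. -/
theorem hentE_le_of_sum_mul_norm_le {S : Type*} [Fintype S] {n : ℕ}
    {f : S × (Fin n → ℤ) → ℝ} (hf : ∀ x, 0 ≤ f x)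
    (hs : Summable f) (hsum : ∑' x, f x = 1) (a : Fin n → ℤ) {M t : ℝ} (ht : 0 ≤ t)
    (hM : ∀ F : Finset (S × (Fin n → ℤ)), ∑ x ∈ F, f x * ‖x.2 - a‖ ≤ M) :
    HentE f ≤ ENNReal.ofReal (2 * n * (Real.log (1 + t) + M / (1 + t)) +
      Fintype.card S * ∑' b : Fin n → ℤ, polyWeight b) := by
  have hnn : ∀ x : S × (Fin n → ℤ), 0 ≤ f x * ‖x.2 - a‖ := fun x =>
    mul_nonneg (hf x) (norm_nonneg _)
  have hsM : Summable fun x : S × (Fin n → ℤ) => f x * ‖x.2 - a‖ := summable_of_sum_le hnn hM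
  have htM : ∑' x : S × (Fin n → ℤ), f x * ‖x.2 - a‖ ≤ M := hsM.tsum_le_of_sum_le hM
  have hw := (hasSum_polyWeight_sub (S := S) a).summable
  have hwt := (hasSum_polyWeight_sub (S := S) a).tsum_eq
  have h1 := hs.mul_right (2 * n * Real.log (1 + t))
  have h2 := hsM.mul_right (2 * n / (1 + t))
  have hlog : 0 ≤ Real.log (1 + t) := Real.log_nonneg (by linarith)
  have hbound : ∀ x : S × (Fin n → ℤ), Real.negMulLog (f x) ≤
      f x * (2 * n * Real.log (1 + t)) + f x * ‖x.2 - a‖ * (2 * n / (1 + t)) +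
        polyWeight (x.2 - a) := fun x => by
    refine (Real.negMulLog_le_mul_neg_log_add (hf x) (polyWeight_pos (x.2 - a))).trans ?_
    have h3 : -Real.log (polyWeight (x.2 - a)) ≤
        2 * n * (Real.log (1 + t) + ‖x.2 - a‖ / (1 + t)) :=
      (neg_log_polyWeight_le _).trans
        (mul_le_mul_of_nonneg_left (Real.log_one_add_le (norm_nonneg _) ht) (by positivity))
    have h4 := mul_le_mul_of_nonneg_left h3 (hf x)
    have h5 : f x * (2 * n * (Real.log (1 + t) + ‖x.2 - a‖ / (1 + t))) =
      f x * (2 * n * Real.log (1 + t)) + f x * ‖x.2 - a‖ * (2 * n / (1 + t)) := by ring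
    linarith
  calc HentE f ≤ ∑' x : S × (Fin n → ℤ), ENNReal.ofReal
        (f x * (2 * n * Real.log (1 + t)) + f x * ‖x.2 - a‖ * (2 * n / (1 + t)) +
          polyWeight (x.2 - a)) :=
        ENNReal.tsum_le_tsum fun x => ENNReal.ofReal_le_ofReal (hbound x)
    _ = ENNReal.ofReal (∑' x : S × (Fin n → ℤ),
        (f x * (2 * n * Real.log (1 + t)) + f x * ‖x.2 - a‖ * (2 * n / (1 + t)) +
          polyWeight (x.2 - a))) := by
        refine (ENNReal.ofReal_tsum_of_nonneg (fun x => ?_) ((h1.add h2).add hw)).symm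
        have := hf x
        have := polyWeight_pos (x.2 - a)
        positivity
    _ ≤ _ := by
        refine ENNReal.ofReal_le_ofReal ?_
        rw [(h1.add h2).tsum_add hw, h1.tsum_add h2, tsum_mul_right, tsum_mul_right, hsum, hwt]
        have h6 := mul_le_mul_of_nonneg_right htM (show (0 : ℝ) ≤ 2 * n / (1 + t) by positivity)
        have h7 : M * (2 * n / (1 + t)) = 2 * n * (M / (1 + t)) := by ring
        linarith

theorem stmt_5 {S : Type} [Fintype S] [DecidableEq S] (hS : 2 ≤ Fintype.card S) {n : ℕ}
    (q : S → S → ℝ)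
    (hq_nonneg : ∀ i j : S, i ≠ j → 0 ≤ q i j)
    (hq_sym : ∀ i j : S, i ≠ j → (0 < q i j ↔ 0 < q j i))
    (hq_conn : ∀ i j : S, Relation.ReflTransGen (fun a b => a ≠ b ∧ 0 < q a b) i j)
    (v : S → S → (Fin n → ℤ)) (hv : ∀ i j, v j i = -(v i j)) :
    -- C and T₀ depend only on S, q, n and v:
    ∃ C : ℝ, 0 < C ∧ ∃ T₀ : ℝ, 2 ≤ T₀ ∧
      ∀ (p : ℝ → S × (Fin n → ℤ) → ℝ), IsMasterSolution q v p →
        ∀ x₀ : S × (Fin n → ℤ),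
          (p 0 x₀ = 1 ∧ ∀ y, y ≠ x₀ → p 0 y = 0) →
          ∀ t : ℝ, T₀ ≤ t → HentE (p t) ≤ ENNReal.ofReal (C * Real.log t) := by
  have hc := driftBound_nonneg hq_nonneg v
  have hW : 0 ≤ ∑' b : Fin n → ℤ, polyWeight b := tsum_nonneg fun b => (polyWeight_pos b).le
  set c := driftBound q v with hcdef
  set W := ∑' b : Fin n → ℤ, polyWeight b
  have hl2 : 0 < Real.log 2 := Real.log_pos one_lt_two
  refine ⟨4 * n + (2 * n * c + Fintype.card S * W) / Real.log 2 + 1, by positivity, 2, le_rfl,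
    fun p hp x₀ h₀ t ht => ?_⟩
  have ht0 : 0 ≤ t := by linarith
  refine (hentE_le_of_sum_mul_norm_le (hp.1 t ht0).1 (hp.summable ht0) (hp.1 t ht0).2 x₀.2 ht0
    (hp.sum_mul_norm_le hq_nonneg h₀.1 ht0)).trans (ENNReal.ofReal_le_ofReal ?_)
  have hlt : Real.log 2 ≤ Real.log t := Real.log_le_log two_pos ht
  have h1 : Real.log (1 + t) ≤ 2 * Real.log t := by
    have : Real.log (1 + t) ≤ Real.log (t ^ 2) := Real.log_le_log (by linarith) (by nlinarith)
    simpa [Real.log_pow] using this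
  have h2 : c * t / (1 + t) ≤ c := by
    rw [div_le_iff₀ (by linarith)]; nlinarith
  have h3 : 2 * n * c + Fintype.card S * W ≤
      (2 * n * c + Fintype.card S * W) / Real.log 2 * Real.log t := by
    rw [div_mul_eq_mul_div, le_div_iff₀ hl2]
    exact mul_le_mul_of_nonneg_left hlt (by positivity)
  have h4 : 2 * n * (Real.log (1 + t) + c * t / (1 + t)) ≤ 2 * n * (2 * Real.log t + c) :=
    mul_le_mul_of_nonneg_left (by linarith) (by positivity)
  linarith
end
end

section
/- Let μ : S × ℤ^n → (0,∞) satisfy detailed balance for the lifted chain L: μ(i,α)·q i j = μ(j, α + v i j)·q j i for all i ≠ j and all α. Let φ = −log μ and, for a solution p of the master equation of L, let E(t) = Σ_x p(t)(x)·φ(x). Assume: (i) for every t > 0, Σ_x |φ(x)|·|d/dt p(t)(x)| < ∞ and Σ_{(i,α)} Σ_{j≠i} p(t)(i,α)·q i j·|φ(j, α+v i j) − φ(i,α)| < ∞, E(t) is finite, and E is differentiable at t with E'(t) = Σ_x φ(x)·(d/dt p(t)(x)); (ii) p̄(t)(i) > 0 for all i and all t > 0, and the folded distribution p̄(t) converges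 pointwise to π̄ as t → ∞. Then lim_{t→∞} E'(t) = −ē_p. -/
open Filter

noncomputable section

/-- The affinity of the edge `(i, j)`. -/
def edgeAffinity {S : Type} (q : S → S → ℝ) (i j : S) : ℝ :=
  Real.log (q i j) - Real.log (q j i)

theorem shift_self_eq_zero {S : Type} {n : ℕ} {v : S → S → (Fin n → ℤ)}
    (hv : ∀ i j, v j i = -(v i j)) (i : S) : v i i = 0 := by
  funext k
  have h := congrFun (hv i i) k
  simp only [Pi.neg_apply, Pi.zero_apply] at h ⊢
  omega

/-- Detailed balance prescribes the increments of `log μ` along the edges of the lifted chain. -/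
theorem log_detailed_balance {S : Type} {n : ℕ} {q : S → S → ℝ}
    (hq_nonneg : ∀ i j : S, i ≠ j → 0 ≤ q i j)
    (hq_sym : ∀ i j : S, i ≠ j → (0 < q i j ↔ 0 < q j i))
    {v : S → S → (Fin n → ℤ)} (hv : ∀ i j, v j i = -(v i j))
    {μ : S × (Fin n → ℤ) → ℝ} (hμpos : ∀ x, 0 < μ x)
    (hdb : ∀ (i j : S), i ≠ j → ∀ α : Fin n → ℤ,
      μ (i, α) * q i j = μ (j, α + v i j) * q j i) (i j : S) (α : Fin n → ℤ) :
    q i j * Real.log (μ (j, α + v i j)) =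
      q i j * (Real.log (μ (i, α)) + edgeAffinity q i j) := by
  unfold edgeAffinity
  rcases eq_or_ne i j with rfl | hij
  · simp [shift_self_eq_zero hv]
  rcases (hq_nonneg i j hij).eq_or_lt with h | h
  · simp [← h]
  have h' := (hq_sym i j hij).1 h
  have hlog := congrArg Real.log (hdb i j hij α)
  rw [Real.log_mul (hμpos _).ne' h.ne', Real.log_mul (hμpos _).ne' h'.ne'] at hlog
  congr 1
  linarith

theorem mEqDeriv_eq_sum {S : Type} [Fintype S] [DecidableEq S] {n : ℕ} (q : S → S → ℝ)
    {v : S → S → (Fin n → ℤ)} (hv : ∀ i j, v j i = -(v i j))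
    (f : S × (Fin n → ℤ) → ℝ) (x : S × (Fin n → ℤ)) :
    mEqDeriv q v f x = ∑ j, (f (j, x.2 + v x.1 j) * q j x.1 - f x * q x.1 j) := by
  unfold mEqDeriv
  apply Finset.sum_erase
  simp [shift_self_eq_zero hv]

/-- The energy dissipation rate depends on the folded distribution only. -/
theorem tsum_energy_mul_mEqDeriv {S : Type} [Fintype S] [DecidableEq S] {n : ℕ}
    {q : S → S → ℝ} (hq_nonneg : ∀ i j : S, i ≠ j → 0 ≤ q i j)
    (hq_sym : ∀ i j : S, i ≠ j → (0 < q i j ↔ 0 < q j i))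
    {v : S → S → (Fin n → ℤ)} (hv : ∀ i j, v j i = -(v i j))
    {μ : S × (Fin n → ℤ) → ℝ} (hμpos : ∀ x, 0 < μ x)
    (hdb : ∀ (i j : S), i ≠ j → ∀ α : Fin n → ℤ,
      μ (i, α) * q i j = μ (j, α + v i j) * q j i)
    {f : S × (Fin n → ℤ) → ℝ} (hf : Summable f)
    (hfE : Summable (fun x => f x * (-Real.log (μ x))))
    (hD : Summable (fun x => (-Real.log (μ x)) * mEqDeriv q v f x)) :
    ∑' x, (-Real.log (μ x)) * mEqDeriv q v f x =
      -∑ i, ∑ j, (∑' α, f (i, α)) * q i j * edgeAffinity q i j := by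
  have hinj : ∀ i : S, Function.Injective (fun α : Fin n → ℤ => (i, α)) :=
    fun i => Prod.mk_right_injective i
  have hF : ∀ i, HasSum (fun α => f (i, α)) (∑' α, f (i, α)) :=
    fun i => (hf.comp_injective (hinj i)).hasSum
  set E : S → ℝ := fun i => ∑' α, f (i, α) * (-Real.log (μ (i, α))) with hEdef
  have hE : ∀ i, HasSum (fun α => f (i, α) * (-Real.log (μ (i, α)))) (E i) :=
    fun i => (hfE.comp_injective (hinj i)).hasSum
  have hterm : ∀ i j, HasSum
      (fun α => (-Real.log (μ (i, α))) * (f (j, α + v i j) * q j i - f (i, α) * q i j))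
      ((E j - (∑' α, f (j, α)) * edgeAffinity q j i) * q j i - E i * q i j) := by
    intro i j
    have h := (((hE j).sub ((hF j).mul_right (edgeAffinity q j i))).mul_right (q j i))
    rw [← (Equiv.addRight (v i j)).hasSum_iff] at h
    refine (h.sub ((hE i).mul_right (q i j))).congr_fun ?_
    intro α
    have hl := log_detailed_balance hq_nonneg hq_sym hv hμpos hdb j i (α + v i j)
    rw [hv i j, add_neg_cancel_right] at hl
    simp only [Function.comp_apply, Equiv.coe_addRight]
    linear_combination (-f (j, α + v i j)) * hl
  have hrow : ∀ i, HasSum (fun α => (-Real.log (μ (i, α))) * mEqDeriv q v f (i, α))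
      (∑ j, ((E j - (∑' α, f (j, α)) * edgeAffinity q j i) * q j i - E i * q i j)) := by
    intro i
    simpa only [mEqDeriv_eq_sum q hv, Finset.mul_sum] using
      hasSum_sum (s := Finset.univ) fun j _ => hterm i j
  rw [hD.tsum_prod' fun i => (hrow i).summable, tsum_fintype]
  simp only [(hrow _).tsum_eq, Finset.sum_sub_distrib, sub_mul]
  rw [Finset.sum_comm (f := fun i j => E j * q j i),
    Finset.sum_comm (f := fun i j => (∑' α, f (j, α)) * edgeAffinity q j i * q j i)]
  simp only [mul_right_comm]
  ring

/-- At stationarity the entropy production rate is the mean affinity. -/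
theorem epBar_eq_sum_edgeAffinity {S : Type} [Fintype S] [DecidableEq S]
    {q : S → S → ℝ} (hq_nonneg : ∀ i j : S, i ≠ j → 0 ≤ q i j)
    (hq_sym : ∀ i j : S, i ≠ j → (0 < q i j ↔ 0 < q j i))
    {g : S → ℝ} (hgpos : ∀ i, 0 < g i)
    (hgstat : ∀ j : S, ∑ i ∈ Finset.univ.erase j, (g i * q i j - g j * q j i) = 0) :
    epBar q g = ∑ i, ∑ j, g i * q i j * edgeAffinity q i j := by
  have hstat : ∀ j, ∑ i, (g i * q i j - g j * q j i) = 0 := fun j => by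
    rw [← hgstat j, Finset.sum_erase]
    ring
  have hterm : ∀ i j, (g i * q i j - g j * q j i) * Real.log ((g i * q i j) / (g j * q j i)) =
      g i * q i j * edgeAffinity q i j + g j * q j i * edgeAffinity q j i
        - Real.log (g i) * (g j * q j i - g i * q i j)
        - Real.log (g j) * (g i * q i j - g j * q j i) := by
    intro i j
    unfold edgeAffinity
    rcases eq_or_ne i j with rfl | hij
    · simp
    rcases (hq_nonneg i j hij).eq_or_lt with h | h
    · have h' : q j i = 0 := le_antisymm
        (not_lt.1 fun hlt => ((hq_sym i j hij).2 hlt).ne h) (hq_nonneg j i hij.symm)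
      simp [← h, h']
    have h' := (hq_sym i j hij).1 h
    rw [Real.log_div (mul_pos (hgpos i) h).ne' (mul_pos (hgpos j) h').ne',
      Real.log_mul (hgpos i).ne' h.ne', Real.log_mul (hgpos j).ne' h'.ne']
    ring
  unfold epBar
  have herase : ∀ i, ∑ j ∈ Finset.univ.erase i,
      (g i * q i j - g j * q j i) * Real.log ((g i * q i j) / (g j * q j i)) =
      ∑ j, (g i * q i j - g j * q j i) * Real.log ((g i * q i j) / (g j * q j i)) :=
    fun i => Finset.sum_erase _ (by simp)
  simp only [herase]
  simp only [hterm, Finset.sum_sub_distrib, Finset.sum_add_distrib]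
  rw [Finset.sum_comm (f := fun i j => g j * q j i * edgeAffinity q j i),
    Finset.sum_comm (f := fun i j => Real.log (g j) * (g i * q i j - g j * q j i))]
  simp only [← Finset.mul_sum, hstat]
  simp
  ring

theorem stmt_7 {S : Type} [Fintype S] [DecidableEq S] (hS : 2 ≤ Fintype.card S) {n : ℕ}
    (q : S → S → ℝ)
    (hq_nonneg : ∀ i j : S, i ≠ j → 0 ≤ q i j)
    (hq_sym : ∀ i j : S, i ≠ j → (0 < q i j ↔ 0 < q j i))
    (hq_conn : ∀ i j : S, Relation.ReflTransGen (fun a b => a ≠ b ∧ 0 < q a b) i j)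
    (πb : S → ℝ) (hπpos : ∀ i, 0 < πb i) (hπsum : ∑ i, πb i = 1)
    (hπstat : ∀ j : S,
      ∑ i ∈ Finset.univ.erase j, (πb i * q i j - πb j * q j i) = 0)
    (v : S → S → (Fin n → ℤ)) (hv : ∀ i j, v j i = -(v i j))
    -- μ satisfies detailed balance for L (φ = -log μ):
    (μ : S × (Fin n → ℤ) → ℝ) (hμpos : ∀ x, 0 < μ x)
    (hdb : ∀ (i j : S), i ≠ j → ∀ α : Fin n → ℤ,
      μ (i, α) * q i j = μ (j, α + v i j) * q j i)
    (p : ℝ → S × (Fin n → ℤ) → ℝ) (hp : IsMasterSolution q v p)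
    -- (i) absolute convergence of Σ |φ|·|dp/dt| and of the flux-weighted potential
    --     differences, finiteness of E(t), and differentiability of E with the stated derivative:
    (habs1 : ∀ t : ℝ, 0 < t →
      Summable (fun x : S × (Fin n → ℤ) =>
        |(-Real.log (μ x))| * |mEqDeriv q v (p t) x|))
    (habs2 : ∀ t : ℝ, 0 < t →
      Summable (fun x : S × (Fin n → ℤ) =>
        ∑ j ∈ Finset.univ.erase x.1,
          p t x * q x.1 j *
            |(-Real.log (μ (j, x.2 + v x.1 j))) - (-Real.log (μ x))|))
    (hEfin : ∀ t : ℝ, 0 < t →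
      Summable (fun x : S × (Fin n → ℤ) => p t x * (-Real.log (μ x))))
    (hE' : ∀ t : ℝ, 0 < t →
      HasDerivAt (fun s : ℝ => ∑' x : S × (Fin n → ℤ), p s x * (-Real.log (μ x)))
        (∑' x : S × (Fin n → ℤ), (-Real.log (μ x)) * mEqDeriv q v (p t) x) t)
    -- (ii) positivity of the folded distribution and its convergence to π̄:
    (hfoldpos : ∀ t : ℝ, 0 < t → ∀ i : S, 0 < ∑' α : Fin n → ℤ, p t (i, α))
    (hfold : ∀ i : S,
      Tendsto (fun t : ℝ => ∑' α : Fin n → ℤ, p t (i, α)) atTop (nhds (πb i))) :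
    -- E'(t) → -ē_p:
    Tendsto (deriv (fun s : ℝ => ∑' x : S × (Fin n → ℤ), p s x * (-Real.log (μ x))))
      atTop (nhds (-(epBar q πb))) := by
  have hrate : ∀ t : ℝ, 0 < t →
      deriv (fun s : ℝ => ∑' x : S × (Fin n → ℤ), p s x * (-Real.log (μ x))) t =
        -∑ i, ∑ j, (∑' α, p t (i, α)) * q i j * edgeAffinity q i j := by
    intro t ht
    have hpt : Summable (p t) := by
      by_contra h
      have h1 := (hp.1 t ht.le).2
      rw [tsum_eq_zero_of_not_summable h] at h1
      exact zero_ne_one h1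
    rw [(hE' t ht).deriv]
    refine tsum_energy_mul_mEqDeriv hq_nonneg hq_sym hv hμpos hdb hpt (hEfin t ht) ?_
    refine Summable.of_abs ?_
    simpa only [abs_mul] using habs1 t ht
  rw [epBar_eq_sum_edgeAffinity hq_nonneg hq_sym hπpos hπstat]
  refine Tendsto.congr' ((eventually_gt_atTop 0).mono fun t ht => (hrate t ht).symm) ?_
  exact (tendsto_finsetSum _ fun i _ => tendsto_finsetSum _ fun j _ =>
    ((hfold i).mul_const _).mul_const _).neg

end
end

section
/- Let (p^x) be a transition family for the lifted chain L, assume the support graph of L (the graph on S × ℤ^n whose edges are pairs {(i,α), (j, α + v i j)} with i ≠ j and q i j > 0) is connected, and assume H[p^x(t)] < ∞ for all states x and all t ≥ 0. Then for every i ∈ S, lim_{t→∞} MI^i(L_1, L_t) = 0. -/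
open Filter

noncomputable section

/-- Mutual information of a joint distribution on a product of countable sets,
with summands vanishing where the joint density vanishes. -/
def MI {Y Z : Type*} (ρ : Y × Z → ℝ) : ℝ :=
  ∑' yz : Y × Z,
    ρ yz * Real.log (ρ yz / ((∑' z, ρ (yz.1, z)) * ∑' y, ρ (y, yz.2)))

theorem tsum_mul_le_of_le_sub {X : Type*} {w f : X → ℝ} {M η : ℝ} (hw : ∀ y, 0 ≤ w y)
    (hw1 : HasSum w 1) (hf0 : ∀ y, 0 ≤ f y) (hf : ∀ y, f y ≤ M) (y₀ : X) (hy₀ : f y₀ ≤ M - η) :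
    ∑' y, w y * f y ≤ M - w y₀ * η := by
  classical
  have h1 : HasSum (fun y => w y * M - if y = y₀ then w y₀ * η else 0) (1 * M - w y₀ * η) :=
    (hw1.mul_right M).sub (hasSum_ite_eq y₀ (w y₀ * η))
  have h2 : Summable fun y => w y * f y :=
    Summable.of_nonneg_of_le (fun y => mul_nonneg (hw y) (hf0 y))
      (fun y => mul_le_mul_of_nonneg_left (hf y) (hw y)) (hw1.mul_right M).summable
  rw [one_mul] at h1
  refine hasSum_le (fun y => ?_) h2.hasSum h1
  by_cases h : y = y₀
  · subst h
    simp only [if_true]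
    nlinarith [hw y]
  · simp only [h, if_false, sub_zero]
    exact mul_le_mul_of_nonneg_left (hf y) (hw y)

theorem eq_zero_of_convex_of_bounded {D : ℕ → ℝ} (h0 : D 0 = 0) {C : ℝ} (hC : ∀ m, D m ≤ C)
    (hD : 0 ≤ D 1) (hconv : ∀ m, 2 * D (m + 1) ≤ D (m + 2) + D m) : D 1 = 0 := by
  have hinc : ∀ m, D 1 ≤ D (m + 1) - D m := by
    intro m
    induction m with
    | zero => simp [h0]
    | succ k ih => linarith [hconv k]
  have hlin : ∀ m : ℕ, (m : ℝ) * D 1 ≤ D m := by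
    intro m
    induction m with
    | zero => simp [h0]
    | succ k ih => push_cast; linarith [hinc k]
  by_contra hne
  have hpos : 0 < D 1 := lt_of_le_of_ne hD (Ne.symm hne)
  obtain ⟨m, hm⟩ := exists_nat_gt (C / D 1)
  rw [div_lt_iff₀ hpos] at hm
  linarith [hlin m, hC m]

/-- The distance of a weighted average to a point is at most the average distance. -/
theorem norm_sub_le_tsum_mul_norm_sub {X E : Type*} [NormedAddCommGroup E] [NormedSpace ℝ E]
    {w : X → ℝ} (hw : ∀ y, 0 ≤ w y) (hw1 : HasSum w 1) {u : X → E} {U e : E} {C : ℝ}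
    (hU : HasSum (fun y => w y • u y) U) (hC : ∀ y, ‖u y - e‖ ≤ C) :
    ‖U - e‖ ≤ ∑' y, w y * ‖u y - e‖ := by
  have h1 : HasSum (fun y => w y • (u y - e)) (U - e) := by
    simpa only [smul_sub, one_smul] using hU.sub (hw1.smul_const e)
  have h2 : Summable fun y => w y * ‖u y - e‖ :=
    Summable.of_nonneg_of_le (fun y => mul_nonneg (hw y) (norm_nonneg _))
      (fun y => mul_le_mul_of_nonneg_left (hC y) (hw y)) (hw1.mul_right C).summable
  refine h1.norm_le_of_bounded h2.hasSum fun y => ?_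
  rw [norm_smul, Real.norm_of_nonneg (hw y)]

section Merging

variable {X E : Type*} [NormedAddCommGroup E] [NormedSpace ℝ E] {A : X → X → ℝ} {u : ℕ → X → E}

/-- Mirror-coupling estimate: if the kernel `A` commutes with `T`, and from every point the
probabilities of staying put and of moving along `T` are both at least `ε`, then the distance between
starting points at offset `T ^ m` is a subsolution of a lazy simple random walk in `m`. -/
theorem norm_step_sub_le_of_mirror {T : Equiv.Perm X} {ε : ℝ}
    (hA1 : ∀ x, HasSum (A x) 1) (hA0 : ∀ x y, 0 ≤ A x y) (hT : ∀ x y, A (T x) (T y) = A x y)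
    (hTx : ∀ x, T x ≠ x) (hε1 : ∀ x, ε ≤ A x x) (hε2 : ∀ x, ε ≤ A x (T x)) (hε : 0 ≤ ε)
    {t : ℕ} (hstep : ∀ x, HasSum (fun y => A x y • u t y) (u (t + 1) x)) {D : ℕ → ℝ}
    (hD : ∀ m x, ‖u t x - u t ((T ^ m) x)‖ ≤ D m) (m : ℕ) (x : X) :
    ‖u (t + 1) x - u (t + 1) ((T ^ (m + 1)) x)‖ ≤
      ε * D (m + 2) + ε * D m + (1 - 2 * ε) * D (m + 1) := by
  classical
  set w : X → ℝ := fun y => A x y - (if y = x then ε else 0) - (if y = T x then ε else 0) with hw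
  have hw0 : ∀ y, 0 ≤ w y := by
    intro y
    by_cases h1 : y = x
    · subst h1
      simpa [hw, (hTx y).symm] using hε1 y
    · by_cases h2 : y = T x
      · subst h2
        simpa [hw, hTx x] using hε2 x
      · simpa [hw, h1, h2] using hA0 x y
  have hw1 : HasSum w (1 - ε - ε) :=
    ((hA1 x).sub (hasSum_ite_eq x ε)).sub (hasSum_ite_eq (T x) ε)
  have hTm : ∀ (k : ℕ) (y z : X), A ((T ^ k) y) ((T ^ k) z) = A y z := by
    intro k
    induction k with
    | zero => intro y z; simp
    | succ k ih => intro y z; rw [pow_succ, Equiv.Perm.mul_apply, Equiv.Perm.mul_apply, ih, hT]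
  have hcorr : ∀ f : X → E, HasSum (fun y => (if y = x then ε • f x else 0) +
      (if y = T x then ε • f (T x) else 0)) (ε • f x + ε • f (T x)) := fun f =>
    (hasSum_ite_eq x _).add (hasSum_ite_eq (T x) _)
  have hsplit : ∀ f : X → E, ∀ F : E, HasSum (fun y => A x y • f y) F →
      HasSum (fun y => w y • f y) (F - (ε • f x + ε • f (T x))) := by
    intro f F hF
    convert hF.sub (hcorr f) using 2 with y
    simp only [hw, sub_smul, ite_smul, zero_smul]
    by_cases h1 : y = x
    · subst h1
      simp [(hTx y).symm]
    · by_cases h2 : y = T x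
      · subst h2
        simp [hTx x]
      · simp [h1, h2]
  have h1 := hsplit _ _ (hstep x)
  have h2 : HasSum (fun y => A x y • u t ((T ^ (m + 1)) y)) (u (t + 1) ((T ^ (m + 1)) x)) := by
    have := (T ^ (m + 1)).hasSum_iff.mpr (hstep ((T ^ (m + 1)) x))
    simpa only [Function.comp_def, hTm] using this
  have h3 := hsplit _ _ h2
  have h4 : ‖(u (t + 1) x - (ε • u t x + ε • u t (T x))) - (u (t + 1) ((T ^ (m + 1)) x) -
      (ε • u t ((T ^ (m + 1)) x) + ε • u t ((T ^ (m + 1)) (T x))))‖ ≤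
      (1 - ε - ε) * D (m + 1) := by
    refine (h1.sub h3).norm_le_of_bounded (hw1.mul_right _) fun y => ?_
    rw [← smul_sub, norm_smul, Real.norm_of_nonneg (hw0 y)]
    exact mul_le_mul_of_nonneg_left (hD _ _) (hw0 y)
  have h5 : ‖ε • (u t x - u t ((T ^ (m + 2)) x))‖ ≤ ε * D (m + 2) := by
    rw [norm_smul, Real.norm_of_nonneg hε]
    exact mul_le_mul_of_nonneg_left (hD _ _) hε
  have h6 : ‖ε • (u t (T x) - u t ((T ^ m) (T x)))‖ ≤ ε * D m := by
    rw [norm_smul, Real.norm_of_nonneg hε]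
    exact mul_le_mul_of_nonneg_left (hD _ _) hε
  have e1 : (T ^ (m + 1)) (T x) = (T ^ (m + 2)) x := by
    rw [pow_succ T (m + 1), Equiv.Perm.mul_apply]
  have e2 : (T ^ m) (T x) = (T ^ (m + 1)) x := by
    rw [pow_succ T m, Equiv.Perm.mul_apply]
  rw [e1] at h4
  rw [e2] at h6
  have e3 : u (t + 1) x - u (t + 1) ((T ^ (m + 1)) x) =
      ε • (u t x - u t ((T ^ (m + 2)) x)) + ε • (u t (T x) - u t ((T ^ (m + 1)) x)) +
      ((u (t + 1) x - (ε • u t x + ε • u t (T x))) - (u (t + 1) ((T ^ (m + 1)) x) -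
      (ε • u t ((T ^ (m + 1)) x) + ε • u t ((T ^ (m + 2)) x)))) := by
    simp only [smul_sub]
    abel
  rw [e3]
  refine (norm_add₃_le).trans ?_
  linarith

theorem tendsto_norm_sub_perm {T : Equiv.Perm X} {ε : ℝ}
    (hA1 : ∀ x, HasSum (A x) 1) (hA0 : ∀ x y, 0 ≤ A x y) (hT : ∀ x y, A (T x) (T y) = A x y)
    (hTx : ∀ x, T x ≠ x) (hε1 : ∀ x, ε ≤ A x x) (hε2 : ∀ x, ε ≤ A x (T x)) (hε : 0 < ε)
    (hstep : ∀ t x, HasSum (fun y => A x y • u t y) (u (t + 1) x)) (hu : ∀ t x, ‖u t x‖ ≤ 1)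
    (hanti : ∀ x x', Antitone fun t => ‖u t x - u t x'‖) (x : X) :
    Tendsto (fun t => ‖u t x - u t (T x)‖) atTop (nhds 0) := by
  have : Nonempty X := ⟨x⟩
  have h2 : ∀ t y y', ‖u t y - u t y'‖ ≤ 2 := fun t y y' =>
    (norm_sub_le _ _).trans (by linarith [hu t y, hu t y'])
  set D : ℕ → ℕ → ℝ := fun t m => ⨆ y, ‖u t y - u t ((T ^ m) y)‖ with hDdef
  have hbdd : ∀ t m, BddAbove (Set.range fun y => ‖u t y - u t ((T ^ m) y)‖) := fun t m =>
    ⟨2, by rintro _ ⟨y, rfl⟩; exact h2 _ _ _⟩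
  have hle : ∀ t m y, ‖u t y - u t ((T ^ m) y)‖ ≤ D t m := fun t m y => le_ciSup (hbdd t m) y
  have hD0 : ∀ t m, 0 ≤ D t m := fun t m => (norm_nonneg _).trans (hle t m x)
  have hDanti : ∀ m, Antitone fun t => D t m := fun m s t hst =>
    ciSup_mono (hbdd s m) fun y => hanti y _ hst
  have hlim : ∀ m, Tendsto (fun t => D t m) atTop (nhds (⨅ t, D t m)) := fun m =>
    tendsto_atTop_ciInf (hDanti m) ⟨0, by rintro _ ⟨t, rfl⟩; exact hD0 t m⟩
  have hconv : ∀ m, 2 * (⨅ t, D t (m + 1)) ≤ (⨅ t, D t (m + 2)) + ⨅ t, D t m := by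
    intro m
    have hs : ∀ t, D (t + 1) (m + 1) ≤
        ε * D t (m + 2) + ε * D t m + (1 - 2 * ε) * D t (m + 1) := fun t =>
      ciSup_le fun y => norm_step_sub_le_of_mirror hA1 hA0 hT hTx hε1 hε2 hε.le (hstep t) (hle t) m y
    have := le_of_tendsto_of_tendsto' ((hlim (m + 1)).comp (tendsto_add_atTop_nat 1))
      ((((hlim (m + 2)).const_mul ε).add ((hlim m).const_mul ε)).add
        ((hlim (m + 1)).const_mul (1 - 2 * ε))) hs
    nlinarith
  have hzero := eq_zero_of_convex_of_bounded (D := fun m => ⨅ t, D t m) (C := 2)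
    (by simp [hDdef]) (fun m => ciInf_le_of_le ⟨0, by rintro _ ⟨t, rfl⟩; exact hD0 t m⟩ 0
      (ciSup_le fun y => h2 _ _ _)) (le_ciInf fun t => hD0 t 1) hconv
  have hl := hlim 1
  rw [show (⨅ t, D t 1) = 0 from hzero] at hl
  exact squeeze_zero (fun t => norm_nonneg _) (fun t => by simpa using hle t 1 x) hl

/-- If `A` is everywhere positive and points with the same image in a finite set merge, then all
points merge. -/
theorem tendsto_norm_sub_of_finite {S : Type*} [Finite S] (c : X → S)
    (hA1 : ∀ x, HasSum (A x) 1) (hA0 : ∀ x y, 0 < A x y)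
    (hstep : ∀ t x, HasSum (fun y => A x y • u t y) (u (t + 1) x)) (hu : ∀ t x, ‖u t x‖ ≤ 1)
    (hanti : ∀ x x', Antitone fun t => ‖u t x - u t x'‖)
    (hc : ∀ x x', c x = c x' → Tendsto (fun t => ‖u t x - u t x'‖) atTop (nhds 0)) (x x' : X) :
    Tendsto (fun t => ‖u t x - u t x'‖) atTop (nhds 0) := by
  have h2 : ∀ s t y y', ‖u s y - u t y'‖ ≤ 2 := fun s t y y' =>
    (norm_sub_le _ _).trans (by linarith [hu s y, hu t y'])
  have hlim : ∀ y y', ∃ a, Tendsto (fun t => ‖u t y - u t y'‖) atTop (nhds a) := fun y y' =>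
    ⟨_, tendsto_atTop_ciInf (hanti y y') ⟨0, by rintro _ ⟨t, rfl⟩; exact norm_nonneg _⟩⟩
  choose a ha using hlim
  have ha0 : ∀ y y', 0 ≤ a y y' := fun y y' =>
    ge_of_tendsto' (ha y y') fun t => norm_nonneg _
  have haself : ∀ y, a y y = 0 := fun y =>
    tendsto_nhds_unique (ha y y) (by simp)
  have hsymm : ∀ y y', a y y' = a y' y := fun y y' =>
    tendsto_nhds_unique (ha y y') (by simpa only [norm_sub_rev] using ha y' y)
  have htri : ∀ y y' y'', a y y'' ≤ a y y' + a y' y'' := fun y y' y'' =>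
    le_of_tendsto_of_tendsto' (ha y y'') ((ha y y').add (ha y' y'')) fun t =>
      norm_sub_le_norm_sub_add_norm_sub _ _ _
  have hac : ∀ y y', c y = c y' → a y y' = 0 := fun y y' h =>
    tendsto_nhds_unique (ha y y') (hc y y' h)
  have hle : ∀ y y', a y y' ≤ ∑' z, A y z * ∑' z', A y' z' * a z z' := by
    intro y y'
    have hin : ∀ z, Tendsto (fun t => ∑' z', A y' z' * ‖u t z - u t z'‖) atTop
        (nhds (∑' z', A y' z' * a z z')) := by
      intro z
      refine tendsto_tsum_of_dominated_convergence ((hA1 y').mul_right 2).summable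
        (fun z' => (ha z z').const_mul _) (Eventually.of_forall fun t z' => ?_)
      rw [norm_mul, norm_norm, Real.norm_of_nonneg (hA0 y' z').le]
      exact mul_le_mul_of_nonneg_left (h2 _ _ _ _) (hA0 y' z').le
    have hin2 : ∀ t z, ∑' z', A y' z' * ‖u t z - u t z'‖ ≤ 2 := by
      intro t z
      have hs := (hA1 y').mul_right 2
      rw [one_mul] at hs
      have hb : ∀ z', A y' z' * ‖u t z - u t z'‖ ≤ A y' z' * 2 := fun z' =>
        mul_le_mul_of_nonneg_left (h2 _ _ _ _) (hA0 y' z').le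
      exact hasSum_le hb (Summable.of_nonneg_of_le
        (fun z' => mul_nonneg (hA0 y' z').le (norm_nonneg _)) hb hs.summable).hasSum hs
    have hin0 : ∀ t z, 0 ≤ ∑' z', A y' z' * ‖u t z - u t z'‖ := fun t z =>
      tsum_nonneg fun z' => mul_nonneg (hA0 y' z').le (norm_nonneg _)
    have hout : Tendsto (fun t => ∑' z, A y z * ∑' z', A y' z' * ‖u t z - u t z'‖) atTop
        (nhds (∑' z, A y z * ∑' z', A y' z' * a z z')) := by
      refine tendsto_tsum_of_dominated_convergence ((hA1 y).mul_right 2).summable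
        (fun z => (hin z).const_mul _) (Eventually.of_forall fun t z => ?_)
      rw [norm_mul, Real.norm_of_nonneg (hin0 t z), Real.norm_of_nonneg (hA0 y z).le]
      exact mul_le_mul_of_nonneg_left (hin2 t z) (hA0 y z).le
    refine le_of_tendsto_of_tendsto' ((ha y y').comp (tendsto_add_atTop_nat 1)) hout fun t => ?_
    have s1 : ∀ z, ‖u t z - u (t + 1) y'‖ ≤ ∑' z', A y' z' * ‖u t z - u t z'‖ := by
      intro z
      rw [norm_sub_rev]
      simp_rw [norm_sub_rev (u t z)]
      exact norm_sub_le_tsum_mul_norm_sub (fun z' => (hA0 y' z').le) (hA1 y') (hstep t y')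
        (C := 2) (fun z' => h2 _ _ _ _)
    refine (norm_sub_le_tsum_mul_norm_sub (fun z => (hA0 y z).le) (hA1 y) (hstep t y)
        (C := 2) (fun z => h2 _ _ _ _)).trans ?_
    have hb : ∀ z, A y z * ‖u t z - u (t + 1) y'‖ ≤
        A y z * ∑' z', A y' z' * ‖u t z - u t z'‖ := fun z =>
      mul_le_mul_of_nonneg_left (s1 z) (hA0 y z).le
    have hsum : Summable fun z => A y z * ∑' z', A y' z' * ‖u t z - u t z'‖ :=
      Summable.of_nonneg_of_le (fun z => mul_nonneg (hA0 y z).le (hin0 t z))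
        (fun z => mul_le_mul_of_nonneg_left (hin2 t z) (hA0 y z).le)
        ((hA1 y).mul_right 2).summable
    exact (Summable.of_nonneg_of_le
      (fun z => mul_nonneg (hA0 y z).le (norm_nonneg _)) hb hsum).tsum_le_tsum hb hsum
  choose r hr using fun i : Set.range c => i.2
  have : Nonempty (Set.range c) := ⟨⟨c x, x, rfl⟩⟩
  obtain ⟨⟨i, j⟩, hmax⟩ := Finite.exists_max fun p : Set.range c × Set.range c => a (r p.1) (r p.2)
  have hM : ∀ y y', a y y' ≤ a (r i) (r j) := by
    intro y y'
    have h1 := htri y (r ⟨c y, y, rfl⟩) y'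
    have h2 := htri (r ⟨c y, y, rfl⟩) (r ⟨c y', y', rfl⟩) y'
    have h3 := hac y (r ⟨c y, y, rfl⟩) (hr ⟨c y, y, rfl⟩).symm
    have h4 := hac (r ⟨c y', y', rfl⟩) y' (hr ⟨c y', y', rfl⟩)
    have h5 := hmax (⟨c y, y, rfl⟩, ⟨c y', y', rfl⟩)
    simp only at h5
    linarith
  set M := a (r i) (r j) with hMdef
  have hinner0 : ∀ z, 0 ≤ ∑' z', A (r j) z' * a z z' := fun z =>
    tsum_nonneg fun z' => mul_nonneg (hA0 _ z').le (ha0 z z')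
  have hinner : ∀ z, ∑' z', A (r j) z' * a z z' ≤ M := by
    intro z
    simpa using tsum_mul_le_of_le_sub (η := 0) (fun z' => (hA0 (r j) z').le) (hA1 (r j))
      (ha0 z) (hM z) z (by simpa using hM z z)
  have hinnerx : ∑' z', A (r j) z' * a x z' ≤ M - A (r j) x * M :=
    tsum_mul_le_of_le_sub (fun z' => (hA0 (r j) z').le) (hA1 (r j)) (ha0 x) (hM x) x
      (by simp [haself])
  have houter := tsum_mul_le_of_le_sub (fun z => (hA0 (r i) z).le) (hA1 (r i)) hinner0 hinner x
    hinnerx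
  have hM0 : M ≤ 0 := by
    have h1 := (hle (r i) (r j)).trans houter
    have h2 : 0 < A (r i) x * A (r j) x := mul_pos (hA0 _ _) (hA0 _ _)
    have h3 : (A (r i) x * A (r j) x) * M ≤ 0 := by rw [← hMdef] at h1; linarith
    exact nonpos_of_mul_nonpos_right h3 h2
  have hzero : a x x' = 0 := le_antisymm ((hM x x').trans hM0) (ha0 x x')
  rw [← hzero]
  exact ha x x'

end Merging
section MasterEquation

variable {S : Type} [Fintype S] [DecidableEq S] {n : ℕ} {q : S → S → ℝ}
  {v : S → S → (Fin n → ℤ)}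

theorem mEqDeriv_sub (f g : S × (Fin n → ℤ) → ℝ) (x : S × (Fin n → ℤ)) :
    mEqDeriv q v (fun y => f y - g y) x = mEqDeriv q v f x - mEqDeriv q v g x := by
  simp only [mEqDeriv, ← Finset.sum_sub_distrib]
  exact Finset.sum_congr rfl fun j _ => by ring

theorem abs_mEqDeriv_le {f : S × (Fin n → ℤ) → ℝ} {B : ℝ} (hf : ∀ y, |f y| ≤ B)
    (x : S × (Fin n → ℤ)) :
    |mEqDeriv q v f x| ≤ (∑ i, ∑ j, (|q j i| + |q i j|)) * B := by
  have hB : 0 ≤ B := (abs_nonneg _).trans (hf x)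
  calc |mEqDeriv q v f x|
      ≤ ∑ j ∈ Finset.univ.erase x.1, (|q j x.1| + |q x.1 j|) * B := by
        refine (Finset.abs_sum_le_sum_abs _ _).trans (Finset.sum_le_sum fun j _ => ?_)
        refine (abs_sub _ _).trans ?_
        rw [abs_mul, abs_mul]
        nlinarith [mul_le_mul_of_nonneg_right (hf (j, x.2 + v x.1 j)) (abs_nonneg (q j x.1)),
          mul_le_mul_of_nonneg_right (hf x) (abs_nonneg (q x.1 j))]
    _ ≤ ∑ j, (|q j x.1| + |q x.1 j|) * B :=
        Finset.sum_le_sum_of_subset_of_nonneg (Finset.erase_subset _ _) fun j _ _ => by positivity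
    _ = (∑ j, (|q j x.1| + |q x.1 j|)) * B := by rw [Finset.sum_mul]
    _ ≤ _ := by
        refine mul_le_mul_of_nonneg_right ?_ hB
        exact Finset.single_le_sum (f := fun i => ∑ j, (|q j i| + |q i j|))
          (fun i _ => Finset.sum_nonneg fun j _ => by positivity) (Finset.mem_univ x.1)

/-- Bounded solutions of the master equation are determined by their initial value. -/
theorem eq_zero_of_hasDerivWithinAt_mEqDeriv {d : ℝ → S × (Fin n → ℤ) → ℝ} {M : ℝ}
    (hM : ∀ t, 0 ≤ t → ∀ x, |d t x| ≤ M) (h0 : ∀ x, d 0 x = 0)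
    (hd : ∀ x t, 0 ≤ t →
      HasDerivWithinAt (fun s => d s x) (mEqDeriv q v (d t) x) (Set.Ici 0) t)
    {t : ℝ} (ht : 0 ≤ t) (x : S × (Fin n → ℤ)) : d t x = 0 := by
  set C : ℝ := ∑ i, ∑ j, (|q j i| + |q i j|)
  have key : ∀ k : ℕ, ∀ t, 0 ≤ t → ∀ x, |d t x| ≤ M * ((C * t) ^ k / k.factorial) := by
    intro k
    induction k with
    | zero => simpa using hM
    | succ k ih =>
      intro t ht x
      have hbound := image_norm_le_of_norm_deriv_right_le_deriv_boundary (a := 0) (b := t)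
        (f := fun s => d s x) (f' := fun s => mEqDeriv q v (d s) x)
        (B := fun s => M * ((C * s) ^ (k + 1) / (k + 1).factorial))
        (B' := fun s => C * (M * ((C * s) ^ k / k.factorial)))
        (fun s hs => ((hd x s hs.1).continuousWithinAt).mono Set.Icc_subset_Ici_self)
        (fun s hs => (hd x s hs.1).mono (Set.Ici_subset_Ici.mpr hs.1))
        (by simp [h0])
        (fun s => by
          have h1 : HasDerivAt (fun s : ℝ => C * s) C s := by
            simpa using (hasDerivAt_id s).const_mul C
          refine (((h1.fun_pow (k + 1)).div_const ((k + 1).factorial : ℝ)).const_mul M).congr_deriv ?_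
          rw [Nat.factorial_succ]
          push_cast
          have : (k.factorial : ℝ) ≠ 0 := by positivity
          field_simp)
        (fun s hs => by
          rw [Real.norm_eq_abs]
          exact abs_mEqDeriv_le (ih s hs.1) x)
      simpa using hbound (Set.right_mem_Icc.mpr ht)
  have hlim : Tendsto (fun k : ℕ => M * ((C * t) ^ k / k.factorial)) atTop (nhds 0) := by
    simpa using (FloorSemiring.tendsto_pow_div_factorial_atTop (C * t)).const_mul M
  exact abs_nonpos_iff.mp (ge_of_tendsto' hlim fun k => key k t ht x)

variable {P : S × (Fin n → ℤ) → ℝ → S × (Fin n → ℤ) → ℝ}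

theorem IsTransitionFamily.nonneg (hP : IsTransitionFamily q v P) (x y : S × (Fin n → ℤ)) {t : ℝ}
    (ht : 0 ≤ t) : 0 ≤ P x t y :=
  ((hP.1 x).1 t ht).1 y

theorem IsTransitionFamily.hasSum_one (hP : IsTransitionFamily q v P) (x : S × (Fin n → ℤ)) {t : ℝ}
    (ht : 0 ≤ t) : HasSum (P x t) 1 := by
  have h := ((hP.1 x).1 t ht).2
  have hs : Summable (P x t) := by
    by_contra hs
    rw [tsum_eq_zero_of_not_summable hs] at h
    exact zero_ne_one h
  exact h ▸ hs.hasSum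

theorem IsTransitionFamily.le_one (hP : IsTransitionFamily q v P) (x y : S × (Fin n → ℤ)) {t : ℝ}
    (ht : 0 ≤ t) : P x t y ≤ 1 :=
  le_hasSum (hP.hasSum_one x ht) y fun z _ => hP.nonneg x z ht

/-- The chain is invariant under translations of the lattice. -/
theorem IsTransitionFamily.translate (hP : IsTransitionFamily q v P) (x y : S × (Fin n → ℤ))
    (γ : Fin n → ℤ) {t : ℝ} (ht : 0 ≤ t) :
    P (x.1, x.2 + γ) t (y.1, y.2 + γ) = P x t y := by
  refine sub_eq_zero.mp (eq_zero_of_hasDerivWithinAt_mEqDeriv (q := q) (v := v) (M := 1)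
    (d := fun t y => P (x.1, x.2 + γ) t (y.1, y.2 + γ) - P x t y) ?_ ?_ ?_ ht y)
  · intro t ht y
    rw [abs_le]
    constructor <;> linarith [hP.nonneg x y ht, hP.le_one x y ht,
      hP.nonneg (x.1, x.2 + γ) (y.1, y.2 + γ) ht, hP.le_one (x.1, x.2 + γ) (y.1, y.2 + γ) ht]
  · intro y
    by_cases h : y = x
    · subst h
      simp [(hP.2.1 _).1]
    · rw [(hP.2.1 x).2 y h, (hP.2.1 (x.1, x.2 + γ)).2, sub_zero]
      contrapose h
      rw [Prod.mk.injEq] at h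
      exact Prod.ext h.1 (add_right_cancel h.2)
  · intro y t ht
    rw [mEqDeriv_sub (fun y => P (x.1, x.2 + γ) t (y.1, y.2 + γ))]
    refine HasDerivWithinAt.fun_sub ?_ ((hP.1 x).2 y t ht)
    refine ((hP.1 (x.1, x.2 + γ)).2 (y.1, y.2 + γ) t ht).congr_deriv ?_
    simp only [mEqDeriv, add_right_comm]

theorem IsTransitionFamily.hasDerivAt_exp_mul (hP : IsTransitionFamily q v P)
    (x y : S × (Fin n → ℤ)) {t : ℝ} (ht : 0 < t) :
    HasDerivAt (fun s => Real.exp ((∑ j ∈ Finset.univ.erase y.1, q y.1 j) * s) * P x s y)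
      (Real.exp ((∑ j ∈ Finset.univ.erase y.1, q y.1 j) * t) *
        ∑ j ∈ Finset.univ.erase y.1, P x t (j, y.2 + v y.1 j) * q j y.1) t := by
  have h1 : HasDerivAt (fun s => P x s y) (mEqDeriv q v (P x t) y) t :=
    ((hP.1 x).2 y t ht.le).hasDerivAt (Ici_mem_nhds ht)
  have h2 : HasDerivAt (fun s : ℝ => Real.exp ((∑ j ∈ Finset.univ.erase y.1, q y.1 j) * s))
      (Real.exp ((∑ j ∈ Finset.univ.erase y.1, q y.1 j) * t) *
        (∑ j ∈ Finset.univ.erase y.1, q y.1 j)) t := by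
    simpa using ((hasDerivAt_id t).const_mul (∑ j ∈ Finset.univ.erase y.1, q y.1 j)).exp
  refine (h2.fun_mul h1).congr_deriv ?_
  rw [mEqDeriv, Finset.sum_sub_distrib, ← Finset.mul_sum]
  ring

theorem IsTransitionFamily.continuousOn_exp_mul (hP : IsTransitionFamily q v P)
    (x y : S × (Fin n → ℤ)) :
    ContinuousOn (fun s => Real.exp ((∑ j ∈ Finset.univ.erase y.1, q y.1 j) * s) * P x s y)
      (Set.Ici 0) := by
  refine ContinuousOn.mul (by fun_prop) fun s hs => ?_
  exact ((hP.1 x).2 y s hs).continuousWithinAt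

theorem IsTransitionFamily.pos_self (hP : IsTransitionFamily q v P)
    (hq : ∀ i j : S, i ≠ j → 0 ≤ q i j) (x : S × (Fin n → ℤ)) {t : ℝ} (ht : 0 ≤ t) :
    0 < P x t x := by
  have hmono : MonotoneOn _ _ := monotoneOn_of_deriv_nonneg (convex_Ici (0 : ℝ))
    (hP.continuousOn_exp_mul x x)
    (fun s hs => by
      rw [interior_Ici] at hs
      exact (hP.hasDerivAt_exp_mul x x hs).differentiableAt.differentiableWithinAt)
    (fun s hs => by
      rw [interior_Ici] at hs
      rw [(hP.hasDerivAt_exp_mul x x hs).deriv]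
      refine mul_nonneg (Real.exp_pos _).le (Finset.sum_nonneg fun j hj => ?_)
      exact mul_nonneg (hP.nonneg _ _ (le_of_lt hs)) (hq _ _ (Finset.ne_of_mem_erase hj)))
  have h := hmono Set.self_mem_Ici ht ht
  simp only [mul_zero, Real.exp_zero, one_mul, (hP.2.1 x).1] at h
  exact pos_of_mul_pos_right (zero_lt_one.trans_le h) (Real.exp_pos _).le

theorem IsTransitionFamily.pos_of_edge (hP : IsTransitionFamily q v P)
    (hq : ∀ i j : S, i ≠ j → 0 ≤ q i j) (hv : ∀ i j, v j i = -(v i j))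
    {x a b : S × (Fin n → ℤ)} (hab : a.1 ≠ b.1) (hqab : 0 < q a.1 b.1)
    (hb : b.2 = a.2 + v a.1 b.1) (ha : ∀ t, 0 < t → 0 < P x t a) {t : ℝ} (ht : 0 < t) :
    0 < P x t b := by
  have hmono : StrictMonoOn _ _ := strictMonoOn_of_deriv_pos (convex_Ici (0 : ℝ))
    (hP.continuousOn_exp_mul x b)
    (fun s hs => by
      rw [interior_Ici] at hs
      rw [(hP.hasDerivAt_exp_mul x b hs).deriv]
      refine mul_pos (Real.exp_pos _) (Finset.sum_pos' (fun j hj => ?_) ⟨a.1, ?_, ?_⟩)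
      · exact mul_nonneg (hP.nonneg _ _ (le_of_lt hs)) (hq _ _ (Finset.ne_of_mem_erase hj))
      · exact Finset.mem_erase.mpr ⟨hab, Finset.mem_univ _⟩
      · have : ((a.1, b.2 + v b.1 a.1) : S × (Fin n → ℤ)) = a :=
          Prod.ext rfl (by simp [hb, hv a.1 b.1])
        rw [this]
        exact mul_pos (ha s hs) hqab)
  have h := hmono Set.self_mem_Ici ht.le ht
  simp only [mul_zero, Real.exp_zero, one_mul] at h
  exact pos_of_mul_pos_right ((hP.nonneg x b le_rfl).trans_lt h) (Real.exp_pos _).le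

theorem IsTransitionFamily.pos (hP : IsTransitionFamily q v P)
    (hq : ∀ i j : S, i ≠ j → 0 ≤ q i j) (hv : ∀ i j, v j i = -(v i j))
    {x y : S × (Fin n → ℤ)}
    (hxy : Relation.ReflTransGen
        (fun a b : S × (Fin n → ℤ) => a.1 ≠ b.1 ∧ 0 < q a.1 b.1 ∧ b.2 = a.2 + v a.1 b.1) x y)
    {t : ℝ} (ht : 0 < t) : 0 < P x t y := by
  induction hxy generalizing t with
  | refl => exact hP.pos_self hq x ht.le
  | tail _ h ih => exact hP.pos_of_edge hq hv h.1 h.2.1 h.2.2 (fun t ht => ih ht) ht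

end MasterEquation

section MutualInformation

theorem sub_le_mul_log_div {a p : ℝ} (ha : 0 < a) (hp : 0 < p) : a - p ≤ a * Real.log (a / p) := by
  have h := Real.one_sub_inv_le_log_of_pos (div_pos ha hp)
  have h2 := mul_le_mul_of_nonneg_left h ha.le
  have h3 : a * (1 - (a / p)⁻¹) = a - p := by field_simp
  linarith

theorem mul_log_div_le_abs_sub_div {a p m : ℝ} (ha : 0 < a) (hp : 0 < p) (hm : 0 < m)
    (hle : m * a ≤ p) : a * Real.log (a / p) ≤ |a - p| / m := by
  have h1 : Real.log (a / p) ≤ (a - p) / p := by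
    have h := Real.log_le_sub_one_of_pos (div_pos ha hp)
    rwa [sub_div, div_self hp.ne']
  have h2 : a / p ≤ 1 / m := by
    rw [div_le_div_iff₀ hp hm]
    linarith
  calc a * Real.log (a / p) ≤ a * ((a - p) / p) := mul_le_mul_of_nonneg_left h1 ha.le
    _ = a / p * (a - p) := by ring
    _ ≤ a / p * |a - p| := mul_le_mul_of_nonneg_left (le_abs_self _) (div_pos ha hp).le
    _ ≤ 1 / m * |a - p| := mul_le_mul_of_nonneg_right h2 (abs_nonneg _)
    _ = |a - p| / m := by ring

theorem mul_log_div_le_mul_neg_log {a p m : ℝ} (ha : 0 < a) (hp : 0 < p) (hm : 0 < m)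
    (hle : m * a ≤ p) : a * Real.log (a / p) ≤ a * -Real.log m := by
  refine mul_le_mul_of_nonneg_left ?_ ha.le
  rw [← Real.log_inv]
  refine Real.log_le_log (div_pos ha hp) ?_
  rw [div_le_iff₀ hp, inv_mul_eq_div, le_div_iff₀ hm]
  linarith

variable {Y Z : Type*}

/-- Bounds for the relative entropy of `a` with respect to a mixture `p` containing `a` with
weight `m`. -/
theorem relative_entropy_bounds {a p : Z → ℝ} {m : ℝ} (ha : ∀ z, 0 < a z) (hp : ∀ z, 0 < p z)
    (hm : 0 < m) (hle : ∀ z, m * a z ≤ p z) (ha1 : HasSum a 1) (hp1 : HasSum p 1) :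
    0 ≤ ∑' z, a z * Real.log (a z / p z) ∧
    ∑' z, a z * Real.log (a z / p z) ≤ (∑' z, |a z - p z|) / m ∧
    ∑' z, a z * Real.log (a z / p z) ≤ -Real.log m := by
  have hsub : HasSum (fun z => a z - p z) 0 := by simpa using ha1.sub hp1
  have habs : Summable fun z => |a z - p z| / m := hsub.summable.abs.div_const m
  have hlow := fun z => sub_le_mul_log_div (ha z) (hp z)
  have hup := fun z => mul_log_div_le_abs_sub_div (ha z) (hp z) hm (hle z)
  have hs : Summable fun z => a z * Real.log (a z / p z) := by
    have : Summable fun z => a z * Real.log (a z / p z) - (a z - p z) :=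
      Summable.of_nonneg_of_le (fun z => sub_nonneg.mpr (hlow z))
        (fun z => sub_le_sub_right (hup z) _) (habs.sub hsub.summable)
    simpa using this.add hsub.summable
  refine ⟨hasSum_le hlow hsub hs.hasSum, ?_, ?_⟩
  · rw [← tsum_div_const]
    exact hs.tsum_le_tsum hup habs
  · have h := hasSum_le (fun z => mul_log_div_le_mul_neg_log (ha z) (hp z) hm (hle z)) hs.hasSum
      (ha1.mul_right (-Real.log m))
    simpa using h

/-- If a family of distributions merges in total variation to its mixture, and the
mixing distribution has finite entropy, then the mutual information tends to zero. -/
theorem tendsto_MI_of_merging {ι : Type*} {l : Filter ι} {μ : Y → ℝ} {A : ι → Y → Z → ℝ}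
    {p : ι → Z → ℝ} (hμ : ∀ y, 0 < μ y) (hμ1 : HasSum μ 1)
    (hμH : Summable fun y => Real.negMulLog (μ y))
    (hA : ∀ᶠ t in l, (∀ y z, 0 < A t y z) ∧ (∀ y, HasSum (A t y) 1) ∧ HasSum (p t) 1 ∧
      ∀ z, HasSum (fun y => μ y * A t y z) (p t z))
    (htv : ∀ y, Tendsto (fun t => ∑' z, |A t y z - p t z|) l (nhds 0)) :
    Tendsto (fun t => MI fun yz : Y × Z => μ yz.1 * A t yz.1 yz.2) l (nhds 0) := by
  set K : ι → Y → ℝ := fun t y => ∑' z, A t y z * Real.log (A t y z / p t z) with hK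
  have hbounds : ∀ᶠ t in l, ∀ y, 0 ≤ K t y ∧ K t y ≤ (∑' z, |A t y z - p t z|) / μ y ∧
      K t y ≤ -Real.log (μ y) := by
    filter_upwards [hA] with t ⟨h0, h1, hp1, hmix⟩ y
    have hle : ∀ y z, μ y * A t y z ≤ p t z := fun y z =>
      le_hasSum (hmix z) y fun y' _ => (mul_pos (hμ y') (h0 y' z)).le
    exact relative_entropy_bounds (h0 y) (fun z => (mul_pos (hμ y) (h0 y z)).trans_le (hle y z))
      (hμ y) (hle y) (h1 y) hp1
  have hK0 : ∀ y, Tendsto (fun t => μ y * K t y) l (nhds 0) := by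
    intro y
    have h := ((htv y).div_const (μ y)).const_mul (μ y)
    rw [zero_div, mul_zero] at h
    refine squeeze_zero' ?_ ?_ h
    · filter_upwards [hbounds] with t ht using mul_nonneg (hμ y).le (ht y).1
    · filter_upwards [hbounds] with t ht using mul_le_mul_of_nonneg_left (ht y).2.1 (hμ y).le
  have hsum : Tendsto (fun t => ∑' y, μ y * K t y) l (nhds 0) := by
    have h := tendsto_tsum_of_dominated_convergence hμH hK0 (by
      filter_upwards [hbounds] with t ht y
      rw [Real.norm_of_nonneg (mul_nonneg (hμ y).le (ht y).1), Real.negMulLog, neg_mul,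
        ← mul_neg]
      exact mul_le_mul_of_nonneg_left (ht y).2.2 (hμ y).le)
    simpa using h
  refine squeeze_zero_norm' ?_ (by simpa only [norm_zero] using hsum.norm)
  filter_upwards [hA] with t ⟨h0, h1, hp1, hmix⟩
  have hterm : (MI fun yz : Y × Z => μ yz.1 * A t yz.1 yz.2) =
      ∑' yz : Y × Z, μ yz.1 * (A t yz.1 yz.2 * Real.log (A t yz.1 yz.2 / p t yz.2)) := by
    refine tsum_congr fun yz => ?_
    simp only [((h1 yz.1).mul_left (μ yz.1)).tsum_eq, (hmix yz.2).tsum_eq, mul_one]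
    rw [mul_div_mul_left _ _ (hμ yz.1).ne', mul_assoc]
  rw [hterm]
  by_cases hs : Summable fun yz : Y × Z =>
      μ yz.1 * (A t yz.1 yz.2 * Real.log (A t yz.1 yz.2 / p t yz.2))
  · rw [hs.tsum_prod]
    simp only [tsum_mul_left, hK, le_refl]
  · rw [tsum_eq_zero_of_not_summable hs, norm_zero]
    exact norm_nonneg _

end MutualInformation

section TotalVariation

open scoped NNReal

variable {S : Type} [Fintype S] [DecidableEq S] {n : ℕ} {q : S → S → ℝ}
  {v : S → S → (Fin n → ℤ)} {P : S × (Fin n → ℤ) → ℝ → S × (Fin n → ℤ) → ℝ}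

/-- The distribution of the chain started at `x` at time `t`, as a vector in `ℓ¹`. -/
def IsTransitionFamily.law (hP : IsTransitionFamily q v P) (t : ℝ≥0) (x : S × (Fin n → ℤ)) :
    lp (fun _ : S × (Fin n → ℤ) => ℝ) 1 :=
  ⟨P x t, memℓp_gen (by simpa using (hP.hasSum_one x t.coe_nonneg).summable.abs)⟩

theorem IsTransitionFamily.law_apply (hP : IsTransitionFamily q v P) (t : ℝ≥0)
    (x y : S × (Fin n → ℤ)) : hP.law t x y = P x t y := rfl

theorem IsTransitionFamily.hasSum_abs_sub (hP : IsTransitionFamily q v P) (s t : ℝ≥0)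
    (x y : S × (Fin n → ℤ)) :
    HasSum (fun z => |P x s z - P y t z|) ‖hP.law s x - hP.law t y‖ := by
  have h := lp.hasSum_norm (p := 1) (by simp) (hP.law s x - hP.law t y)
  simpa [IsTransitionFamily.law_apply] using h

theorem IsTransitionFamily.norm_law (hP : IsTransitionFamily q v P) (t : ℝ≥0)
    (x : S × (Fin n → ℤ)) : ‖hP.law t x‖ = 1 := by
  have h := lp.hasSum_norm (p := 1) (by simp) (hP.law t x)
  have h2 : HasSum (fun z => |P x t z|) ‖hP.law t x‖ := by
    simpa [IsTransitionFamily.law_apply] using h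
  simp only [abs_of_nonneg (hP.nonneg x _ t.coe_nonneg)] at h2
  exact h2.unique (hP.hasSum_one x t.coe_nonneg)

theorem IsTransitionFamily.hasSum_law (hP : IsTransitionFamily q v P) (s t : ℝ≥0)
    (x : S × (Fin n → ℤ)) : HasSum (fun y => P x s y • hP.law t y) (hP.law (s + t) x) := by
  have hs : Summable fun y => P x s y • hP.law t y := by
    refine Summable.of_norm_bounded (hP.hasSum_one x s.coe_nonneg).summable fun y => ?_
    rw [norm_smul, hP.norm_law, mul_one, Real.norm_of_nonneg (hP.nonneg x y s.coe_nonneg)]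
  convert hs.hasSum using 1
  ext z
  have h := (lp.evalCLM ℝ (fun _ : S × (Fin n → ℤ) => ℝ) 1 z).hasSum hs.hasSum
  refine Eq.trans ?_ h.tsum_eq
  rw [hP.law_apply, NNReal.coe_add, hP.2.2 x z s t s.coe_nonneg t.coe_nonneg]
  rfl

theorem IsTransitionFamily.antitone_norm_law_sub (hP : IsTransitionFamily q v P)
    (x x' : S × (Fin n → ℤ)) : Antitone fun t => ‖hP.law t x - hP.law t x'‖ := by
  intro s t hst
  obtain ⟨r, rfl⟩ := exists_add_of_le hst
  refine ((hP.hasSum_law s r x).sub (hP.hasSum_law s r x')).norm_le_of_bounded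
    (hP.hasSum_abs_sub s s x x') fun y => ?_
  rw [← sub_smul, norm_smul, hP.norm_law, mul_one, Real.norm_eq_abs]

theorem IsTransitionFamily.tendsto_norm_law_sub_nat (hP : IsTransitionFamily q v P)
    (hpos : ∀ x y, 0 < P x 1 y) (x x' : S × (Fin n → ℤ)) :
    Tendsto (fun k : ℕ => ‖hP.law k x - hP.law k x'‖) atTop (nhds 0) := by
  have hA1 : ∀ x, HasSum (P x 1) 1 := fun x => hP.hasSum_one x zero_le_one
  have hstep : ∀ (k : ℕ) x, HasSum (fun y => P x 1 y • hP.law k y) (hP.law (k + 1 : ℕ) x) := by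
    intro k x
    have h := hP.hasSum_law 1 k x
    rw [add_comm] at h
    simpa using h
  have hanti : ∀ x x', Antitone fun k : ℕ => ‖hP.law k x - hP.law k x'‖ := fun x x' =>
    (hP.antitone_norm_law_sub x x').comp_monotone Nat.mono_cast
  refine tendsto_norm_sub_of_finite Prod.fst hA1 hpos hstep (fun k x => (hP.norm_law k x).le) hanti
    (fun y y' hyy' => ?_) x x'
  obtain ⟨i, α⟩ := y
  obtain ⟨j, β⟩ := y'
  obtain rfl : i = j := hyy'
  by_cases hg : β - α = 0
  · rw [sub_eq_zero.mp hg]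
    simp
  have : Nonempty S := ⟨i⟩
  obtain ⟨k, hk⟩ := Finite.exists_min fun k : S =>
    min (P (k, 0) 1 (k, 0)) (P (k, 0) 1 (k, β - α))
  set T : Equiv.Perm (S × (Fin n → ℤ)) := Equiv.prodCongr (Equiv.refl S) (Equiv.addRight (β - α))
    with hT
  have hTapp : ∀ y, T y = (y.1, y.2 + (β - α)) := fun y => rfl
  have h := tendsto_norm_sub_perm (T := T) hA1 (fun x y => (hpos x y).le)
    (fun x y => hP.translate x y _ zero_le_one)
    (fun y hy => hg (by simpa [hTapp] using congrArg Prod.snd hy))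
    (fun y => ((hk y.1).trans (min_le_left _ _)).trans_eq (by
      simpa using (hP.translate (y.1, 0) (y.1, 0) y.2 zero_le_one).symm))
    (fun y => ((hk y.1).trans (min_le_right _ _)).trans_eq (by
      simpa [hTapp, add_comm] using
        (hP.translate (y.1, 0) (y.1, β - α) y.2 zero_le_one).symm))
    (lt_min (hpos _ _) (hpos _ _)) hstep (fun k x => (hP.norm_law k x).le) hanti (i, α)
  simpa [hTapp] using h

theorem IsTransitionFamily.tendsto_norm_law_sub (hP : IsTransitionFamily q v P)
    (hpos : ∀ x y, 0 < P x 1 y) (x x' : S × (Fin n → ℤ)) :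
    Tendsto (fun t => ‖hP.law t x - hP.law t x'‖) atTop (nhds 0) := by
  have h := tendsto_atTop_ciInf (hP.antitone_norm_law_sub x x')
    ⟨0, by rintro _ ⟨t, rfl⟩; exact norm_nonneg _⟩
  have h2 := tendsto_nhds_unique (h.comp tendsto_natCast_atTop_atTop)
    (hP.tendsto_norm_law_sub_nat hpos x x')
  rwa [h2] at h

/-- The laws of the chain at time `s`, started at `y`, and at time `r + s`, started at `x`,
merge in total variation. -/
theorem IsTransitionFamily.tendsto_norm_law_sub_add (hP : IsTransitionFamily q v P)
    (hpos : ∀ x y, 0 < P x 1 y) (r : ℝ≥0) (x y : S × (Fin n → ℤ)) :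
    Tendsto (fun s => ‖hP.law s y - hP.law (r + s) x‖) atTop (nhds 0) := by
  have h2 : ∀ s y y', ‖hP.law s y - hP.law s y'‖ ≤ 2 := fun s y y' =>
    (norm_sub_le _ _).trans (by rw [hP.norm_law, hP.norm_law]; norm_num)
  have h := tendsto_tsum_of_dominated_convergence
    (f := fun s y' => P x r y' * ‖hP.law s y' - hP.law s y‖)
    ((hP.hasSum_one x r.coe_nonneg).mul_right 2).summable
    (fun y' => (hP.tendsto_norm_law_sub hpos y' y).const_mul (P x r y'))
    (Eventually.of_forall fun s y' => by
      rw [norm_mul, norm_norm, Real.norm_of_nonneg (hP.nonneg x y' r.coe_nonneg)]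
      exact mul_le_mul_of_nonneg_left (h2 _ _ _) (hP.nonneg x y' r.coe_nonneg))
  simp only [mul_zero, tsum_zero] at h
  refine squeeze_zero (fun s => norm_nonneg _) (fun s => ?_) h
  rw [norm_sub_rev]
  exact norm_sub_le_tsum_mul_norm_sub (fun y' => hP.nonneg x y' r.coe_nonneg) (hP.hasSum_one x r.coe_nonneg)
    (hP.hasSum_law r s x) (fun y' => h2 s y' y)

theorem IsTransitionFamily.hasSum_mul (hP : IsTransitionFamily q v P) {s t : ℝ} (hs : 0 ≤ s)
    (ht : 0 ≤ t) (x z : S × (Fin n → ℤ)) :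
    HasSum (fun y => P x s y * P y t z) (P x (s + t) z) := by
  rw [hP.2.2 x z s t hs ht]
  refine (Summable.of_nonneg_of_le (fun y => mul_nonneg (hP.nonneg x y hs) (hP.nonneg y z ht))
    (fun y => ?_) (hP.hasSum_one x hs).summable).hasSum
  exact mul_le_of_le_one_right (hP.nonneg x y hs) (hP.le_one y z ht)

end TotalVariation

theorem stmt_8 {S : Type} [Fintype S] [DecidableEq S] (hS : 2 ≤ Fintype.card S) {n : ℕ}
    (q : S → S → ℝ)
    (hq_nonneg : ∀ i j : S, i ≠ j → 0 ≤ q i j)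
    (hq_sym : ∀ i j : S, i ≠ j → (0 < q i j ↔ 0 < q j i))
    (hq_conn : ∀ i j : S, Relation.ReflTransGen (fun a b => a ≠ b ∧ 0 < q a b) i j)
    (v : S → S → (Fin n → ℤ)) (hv : ∀ i j, v j i = -(v i j))
    (P : S × (Fin n → ℤ) → ℝ → S × (Fin n → ℤ) → ℝ)
    (hP : IsTransitionFamily q v P)
    -- the support graph of L is connected:
    (hLconn : ∀ x y : S × (Fin n → ℤ),
      Relation.ReflTransGen
        (fun a b : S × (Fin n → ℤ) => a.1 ≠ b.1 ∧ 0 < q a.1 b.1 ∧ b.2 = a.2 + v a.1 b.1) x y)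
    -- finite entropy at all times and all starting states:
    (hH : ∀ x : S × (Fin n → ℤ), ∀ t : ℝ, 0 ≤ t →
      Summable (fun z => Real.negMulLog (P x t z))) :
    ∀ i : S,
      Tendsto
        (fun t : ℝ =>
          MI (fun yz : (S × (Fin n → ℤ)) × (S × (Fin n → ℤ)) =>
            P (i, (0 : Fin n → ℤ)) 1 yz.1 * P yz.1 (t - 1) yz.2))
        atTop (nhds 0) := by
  intro i
  have hpos : ∀ x y, ∀ t : ℝ, 0 < t → 0 < P x t y := fun x y t ht =>
    hP.pos hq_nonneg hv (hLconn x y) ht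
  refine tendsto_MI_of_merging (μ := P (i, 0) 1) (A := fun t y z => P y (t - 1) z)
    (p := fun t => P (i, 0) t) (fun y => hpos _ _ _ one_pos) (hP.hasSum_one _ zero_le_one)
    (hH _ _ zero_le_one) ?_ ?_
  · filter_upwards [eventually_gt_atTop 1] with t ht
    refine ⟨fun y z => hpos _ _ _ (sub_pos.mpr ht), fun y => hP.hasSum_one _ (sub_pos.mpr ht).le,
      hP.hasSum_one _ (zero_lt_one.trans ht).le, fun z => ?_⟩
    simpa using hP.hasSum_mul zero_le_one (sub_pos.mpr ht).le (i, 0) z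
  · intro y
    have hlim := (hP.tendsto_norm_law_sub_add (fun x y => hpos x y 1 one_pos) 1 (i, 0) y).comp
      (tendsto_real_toNNReal_atTop.comp (tendsto_atTop_add_const_right atTop (-1 : ℝ) tendsto_id))
    refine hlim.congr' ?_
    filter_upwards [eventually_gt_atTop 1] with t ht
    have h := (hP.hasSum_abs_sub (t - 1).toNNReal (1 + (t - 1).toNNReal) y (i, 0)).tsum_eq
    rw [NNReal.coe_add, NNReal.coe_one, Real.coe_toNNReal _ (sub_pos.mpr ht).le,
      add_sub_cancel] at h
    rw [h]
    rfl

end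
end
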